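/- arXiv:1807.10113 — 4 statements merged into one kernel-verified Lean document; each statement's English description precedes it below -/
import Mathlib

section
/- For all real numbers c, ε > 0 and every integer m ≥ 1, there exist a positive integer k = k(c, ε, m) and a real number η = η(c, ε, m) > 0 such that the following holds. If G is a finite group of order n containing a product-free subset A with |A| ≥ c·n, then there exist symmetric subsets X_m ⊆ X_{m-1} ⊆ ... ⊆ X_1 ⊆ (AA⁻¹)² of G, each containing the identity, such that X_{i+1}² ⊆ X_i for all 1 ≤ i < m, the group G is covered by at most k left-translates of X_m, |X_1 \ AA⁻¹| < ε·n, and there is some x ∈ A such that X_1·x ⊆ AA⁻¹A and |X_m·x ∩ A| ≥ η·n. -/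
open Pointwise

/-- A subset `A` of a group is product-free if there are no `x, y, z ∈ A` with `x * y = z`. -/
def ProductFree {G : Type*} [Group G] (A : Set G) : Prop :=
  ∀ x ∈ A, ∀ y ∈ A, x * y ∉ A

open Finset

section AlmostPeriods

variable {G : Type*} [Group G] [Fintype G]

open Classical in
/-- The indicator function of a set, with real values. -/
noncomputable def realIndicator {α : Type*} (A : Set α) (x : α) : ℝ := if x ∈ A then 1 else 0

/-- The normalised overlap `|A ∩ g⁻¹A| / |G|`. -/
noncomputable def overlap (A : Set G) (g : G) : ℝ :=
  (∑ x, realIndicator A (g * x) * realIndicator A x) / Fintype.card G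

/-- The elements that move the overlap function by at most `δ` in the normalised `L¹` norm. -/
def almostPeriods (A : Set G) (δ : ℝ) : Set G :=
  {t | ∑ g, |overlap A (t * g) - overlap A g| ≤ δ * Fintype.card G}

lemma realIndicator_nonneg {α : Type*} (A : Set α) (x : α) : 0 ≤ realIndicator A x := by
  unfold realIndicator; split_ifs <;> norm_num

lemma realIndicator_le_one {α : Type*} (A : Set α) (x : α) : realIndicator A x ≤ 1 := by
  unfold realIndicator; split_ifs <;> norm_num

lemma mem_of_realIndicator_ne_zero {α : Type*} {A : Set α} {x : α} (h : realIndicator A x ≠ 0) :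
    x ∈ A := by
  by_contra hx; exact h (if_neg hx)

lemma sum_realIndicator_mul {α : Type*} [Fintype α] (A : Set α) [DecidablePred (· ∈ A)]
    (φ : α → ℝ) : ∑ x, realIndicator A x * φ x = ∑ x with x ∈ A, φ x := by
  rw [Finset.sum_filter]
  refine Finset.sum_congr rfl fun x _ => ?_
  unfold realIndicator; split_ifs <;> simp

lemma sum_realIndicator {α : Type*} [Fintype α] (A : Set α) :
    ∑ x, realIndicator A x = A.ncard := by
  classical
  have h := sum_realIndicator_mul A (fun _ => (1 : ℝ))
  simp only [mul_one, Finset.sum_const, nsmul_eq_mul] at h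
  rw [h, Set.ncard_eq_toFinset_card']
  congr 2
  ext
  simp

lemma card_pos_real : (0 : ℝ) < Fintype.card G := by exact_mod_cast Fintype.card_pos

lemma overlap_nonneg (A : Set G) (g : G) : 0 ≤ overlap A g :=
  div_nonneg (Finset.sum_nonneg fun _ _ =>
    mul_nonneg (realIndicator_nonneg _ _) (realIndicator_nonneg _ _)) (Nat.cast_nonneg _)

lemma overlap_le_one (A : Set G) (g : G) : overlap A g ≤ 1 := by
  unfold overlap
  rw [div_le_one card_pos_real]
  calc _ ≤ ∑ _x : G, (1 : ℝ) := Finset.sum_le_sum fun x _ =>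
        mul_le_one₀ (realIndicator_le_one _ _) (realIndicator_nonneg _ _) (realIndicator_le_one _ _)
    _ = _ := by simp

lemma overlap_inv (A : Set G) (g : G) : overlap A g⁻¹ = overlap A g := by
  unfold overlap
  congr 1
  rw [← Equiv.sum_comp (Equiv.mulLeft g)]
  simp [mul_comm]

lemma mem_mul_inv_of_overlap_ne_zero {A : Set G} {g : G} (h : overlap A g ≠ 0) :
    g ∈ (A * A⁻¹ : Set G) := by
  have h' : ∑ x, realIndicator A (g * x) * realIndicator A x ≠ 0 := fun h0 =>
    h (by simp [overlap, h0])
  obtain ⟨x, -, hx⟩ := Finset.exists_ne_zero_of_sum_ne_zero h'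
  exact ⟨g * x, mem_of_realIndicator_ne_zero (left_ne_zero_of_mul hx), x⁻¹,
    by simpa using mem_of_realIndicator_ne_zero (right_ne_zero_of_mul hx), by simp⟩

lemma overlap_mul_eq (A : Set G) (t g : G) :
    overlap A (t * g) =
      (∑ y, realIndicator A (t * y) * realIndicator A (g⁻¹ * y)) / Fintype.card G := by
  unfold overlap
  rw [← Equiv.sum_comp (Equiv.mulLeft g)
    (fun y => realIndicator A (t * y) * realIndicator A (g⁻¹ * y))]
  simp [mul_assoc]

lemma sum_overlap (A : Set G) :
    ∑ g, overlap A g = (A.ncard : ℝ) ^ 2 / Fintype.card G := by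
  unfold overlap
  rw [← Finset.sum_div, Finset.sum_comm]
  congr 1
  simp_rw [← Finset.sum_mul]
  have h (x : G) : ∑ g, realIndicator A (g * x) = A.ncard := by
    rw [← sum_realIndicator A]
    exact Equiv.sum_comp (Equiv.mulRight x) _
  simp_rw [h, ← Finset.mul_sum, sum_realIndicator, sq]

lemma le_sum_overlap_sq {A : Set G} {c : ℝ} (hc : 0 ≤ c)
    (hA : c * Fintype.card G ≤ A.ncard) :
    c ^ 4 * Fintype.card G ≤ ∑ g, overlap A g ^ 2 := by
  have hN := card_pos_real (G := G)
  have h := sq_sum_le_card_mul_sum_sq (s := (Finset.univ : Finset G)) (f := overlap A)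
  rw [sum_overlap, Finset.card_univ] at h
  have h1 : c ^ 2 * Fintype.card G ≤ (A.ncard : ℝ) ^ 2 / Fintype.card G := by
    rw [le_div_iff₀ hN]
    nlinarith [mul_nonneg hc hN.le]
  have h2 : (c ^ 2 * (Fintype.card G : ℝ)) ^ 2 ≤ Fintype.card G * ∑ g, overlap A g ^ 2 :=
    (pow_le_pow_left₀ (by positivity) h1 2).trans h
  refine le_of_mul_le_mul_left ?_ hN
  calc _ = (c ^ 2 * (Fintype.card G : ℝ)) ^ 2 := by ring
    _ ≤ _ := h2

lemma one_mem_almostPeriods (A : Set G) {δ : ℝ} (hδ : 0 ≤ δ) : (1 : G) ∈ almostPeriods A δ := by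
  simp only [almostPeriods, Set.mem_ofPred_eq, one_mul, sub_self, abs_zero, Finset.sum_const_zero]
  positivity

lemma inv_mem_almostPeriods {A : Set G} {δ : ℝ} {t : G} (ht : t ∈ almostPeriods A δ) :
    t⁻¹ ∈ almostPeriods A δ := by
  simp only [almostPeriods, Set.mem_ofPred_eq] at ht ⊢
  rw [← Equiv.sum_comp (Equiv.mulLeft t)]
  simpa [abs_sub_comm] using ht

lemma inv_almostPeriods (A : Set G) (δ : ℝ) : (almostPeriods A δ)⁻¹ = almostPeriods A δ :=
  Set.ext fun _ => ⟨fun h => by simpa using inv_mem_almostPeriods (Set.mem_inv.1 h),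
    fun h => Set.mem_inv.2 (inv_mem_almostPeriods h)⟩

lemma almostPeriods_mono (A : Set G) {δ δ' : ℝ} (h : δ ≤ δ') :
    almostPeriods A δ ⊆ almostPeriods A δ' := fun _ ht =>
  le_trans ht (mul_le_mul_of_nonneg_right h (Nat.cast_nonneg _))

lemma mul_mem_almostPeriods {A : Set G} {δ δ' : ℝ} {s t : G} (hs : s ∈ almostPeriods A δ)
    (ht : t ∈ almostPeriods A δ') : s * t ∈ almostPeriods A (δ + δ') := by
  simp only [almostPeriods, Set.mem_ofPred_eq] at hs ht ⊢
  rw [← Equiv.sum_comp (Equiv.mulLeft t)] at hs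
  rw [add_mul]
  refine le_trans ?_ (add_le_add hs ht)
  rw [← Finset.sum_add_distrib]
  refine Finset.sum_le_sum fun g _ => ?_
  simpa [mul_assoc] using abs_sub_le (overlap A (s * (t * g))) (overlap A (t * g)) (overlap A g)

lemma sum_abs_overlap_mul_right_sub_le {A : Set G} {δ : ℝ} {t : G} (ht : t ∈ almostPeriods A δ) :
    ∑ g, |overlap A (g * t) - overlap A g| ≤ δ * Fintype.card G := by
  have h := inv_mem_almostPeriods ht
  simp only [almostPeriods, Set.mem_ofPred_eq] at h
  rw [← Equiv.sum_comp (Equiv.inv G)] at h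
  refine le_of_eq_of_le (Finset.sum_congr rfl fun g _ => ?_) h
  rw [← overlap_inv A (g * t), ← overlap_inv A g]
  simp

/-- The second moment of a sum of independent centred variables bounded by one. -/
lemma sum_sq_sum_le {α : Type*} [Fintype α] {ψ : α → ℝ} (h0 : ∑ x, ψ x = 0)
    (h1 : ∀ x, |ψ x| ≤ 1) (k : ℕ) :
    ∑ y : Fin k → α, (∑ i, ψ (y i)) ^ 2 ≤ k * (Fintype.card α : ℝ) ^ k := by
  induction k with
  | zero => simp
  | succ k ih =>
    rw [← (Fin.consEquiv fun _ => α).sum_comp, Fintype.sum_prod_type]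
    have h2 : ∑ x, ψ x ^ 2 ≤ Fintype.card α := by
      calc _ ≤ ∑ _x : α, (1 : ℝ) := Finset.sum_le_sum fun x _ => (sq_le_one_iff_abs_le_one _).2 (h1 x)
        _ = _ := by simp
    simp only [Fin.consEquiv_apply, Fin.sum_univ_succ, Fin.cons_zero, Fin.cons_succ, add_sq,
      Finset.sum_add_distrib, ← Finset.mul_sum, ← Finset.sum_mul, h0, Finset.sum_const,
      Finset.card_univ, nsmul_eq_mul, Fintype.card_fun, Fintype.card_fin]
    push_cast
    have h3 := mul_le_mul_of_nonneg_left h2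
      (pow_nonneg (Nat.cast_nonneg (Fintype.card α) : (0 : ℝ) ≤ Fintype.card α) k)
    have h4 := mul_le_mul_of_nonneg_left ih (Nat.cast_nonneg (Fintype.card α) : (0 : ℝ) ≤ _)
    rw [pow_succ]
    linarith

/-- Random sampling gives a good approximation to all left translates of the overlap function. -/
lemma exists_sample (A : Set G) {k : ℕ} (hk : 0 < k) :
    ∃ y : Fin k → G, ∑ t, ∑ g,
      ((∑ i, realIndicator A (t * y i) * realIndicator A (g⁻¹ * y i)) / k
        - overlap A (t * g)) ^ 2 ≤ (Fintype.card G : ℝ) ^ 2 / k := by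
  have hN := card_pos_real (G := G)
  have hk' : (0 : ℝ) < k := by exact_mod_cast hk
  have hvar (t g : G) : ∑ y : Fin k → G,
      ((∑ i, realIndicator A (t * y i) * realIndicator A (g⁻¹ * y i)) / k
        - overlap A (t * g)) ^ 2 ≤ (Fintype.card G : ℝ) ^ k / k := by
    have h := sum_sq_sum_le (ψ := fun x => realIndicator A (t * x) * realIndicator A (g⁻¹ * x)
      - overlap A (t * g)) (by
        rw [Finset.sum_sub_distrib, overlap_mul_eq]
        simp only [Finset.sum_const, Finset.card_univ, nsmul_eq_mul]
        field_simp
        simp) (fun x => by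
        have h1 := overlap_nonneg A (t * g)
        have h2 := overlap_le_one A (t * g)
        have h3 := mul_nonneg (realIndicator_nonneg A (t * x)) (realIndicator_nonneg A (g⁻¹ * x))
        have h4 := mul_le_one₀ (realIndicator_le_one A (t * x)) (realIndicator_nonneg A (g⁻¹ * x))
          (realIndicator_le_one A (g⁻¹ * x))
        rw [abs_le]; constructor <;> linarith) k
    calc _ = (∑ y : Fin k → G, (∑ i, (realIndicator A (t * y i) * realIndicator A (g⁻¹ * y i)
          - overlap A (t * g))) ^ 2) / (k : ℝ) ^ 2 := by
          rw [Finset.sum_div]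
          refine Finset.sum_congr rfl fun y _ => ?_
          rw [Finset.sum_sub_distrib, ← div_pow, sub_div]
          simp only [Finset.sum_const, Finset.card_univ, Fintype.card_fin, nsmul_eq_mul]
          rw [mul_div_cancel_left₀ _ hk'.ne']
      _ ≤ (k * (Fintype.card G : ℝ) ^ k) / (k : ℝ) ^ 2 := by gcongr
      _ = _ := by field_simp
  obtain ⟨y, -, hy⟩ := Finset.exists_le_of_sum_le (s := (Finset.univ : Finset (Fin k → G)))
    (f := fun y => ∑ t, ∑ g,
      ((∑ i, realIndicator A (t * y i) * realIndicator A (g⁻¹ * y i)) / k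
        - overlap A (t * g)) ^ 2)
    (g := fun _ => (Fintype.card G : ℝ) ^ 2 / k) ⟨fun _ => 1, Finset.mem_univ _⟩ (by
      rw [Finset.sum_comm]
      calc _ ≤ ∑ _t : G, ∑ _g : G, (Fintype.card G : ℝ) ^ k / k := by
            refine Finset.sum_le_sum fun t _ => ?_
            rw [Finset.sum_comm]
            exact Finset.sum_le_sum fun g _ => hvar t g
        _ = _ := by
            simp only [Finset.sum_const, Finset.card_univ, nsmul_eq_mul, Fintype.card_fun,
              Fintype.card_fin]
            push_cast
            ring)
  exact ⟨y, hy⟩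

/-- The Markov inequality in the form: at most half of the values exceed twice the mean. -/
lemma card_le_two_mul_card_filter_le {α : Type*} [Fintype α] {D : α → ℝ} {M : ℝ} (hM : 0 < M)
    (hD : ∀ t, 0 ≤ D t) (h : ∑ t, D t ≤ Fintype.card α * M) :
    (Fintype.card α : ℝ) ≤ 2 * #{t | D t ≤ 2 * M} := by
  have h1 : (#{t | ¬ D t ≤ 2 * M} : ℝ) * (2 * M) ≤ ∑ t, D t := by
    rw [← nsmul_eq_mul]
    refine (Finset.card_nsmul_le_sum _ D _ fun t ht => ?_).trans
      (Finset.sum_le_sum_of_subset_of_nonneg (Finset.subset_univ _) fun t _ _ => hD t)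
    exact (not_le.1 (Finset.mem_filter.1 ht).2).le
  have h2 : (#{t | D t ≤ 2 * M} : ℝ) + #{t | ¬ D t ≤ 2 * M} = Fintype.card α := by
    exact_mod_cast Finset.card_filter_add_card_filter_not (s := Finset.univ) (fun t => D t ≤ 2 * M)
  have h3 : (#{t | ¬ D t ≤ 2 * M} : ℝ) * 2 ≤ Fintype.card α :=
    le_of_mul_le_mul_right (by linarith) hM
  linarith

lemma exists_cover_almostPeriods (A : Set G) {δ : ℝ} (hδ : 0 < δ) {k : ℕ} (hk : 8 ≤ δ ^ 2 * k) :
    ∃ T : Finset G, #T ≤ 2 ^ (k + 1) ∧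
      (Set.univ : Set G) ⊆ ⋃ g ∈ T, g • almostPeriods A δ := by
  classical
  have hN := card_pos_real (G := G)
  have hk' : (0 : ℝ) < k := by
    by_contra h0
    nlinarith [sq_nonneg δ]
  obtain ⟨y, hy⟩ := exists_sample A (k := k) (by exact_mod_cast hk')
  set D : G → ℝ := fun t => ∑ g,
      ((∑ i, realIndicator A (t * y i) * realIndicator A (g⁻¹ * y i)) / k
        - overlap A (t * g)) ^ 2 with hD
  have hQ := card_le_two_mul_card_filter_le (D := D) (M := Fintype.card G / k) (by positivity)
    (fun t => Finset.sum_nonneg fun _ _ => sq_nonneg _) (hy.trans_eq (by ring))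
  set Q : Finset G := {t | D t ≤ 2 * (Fintype.card G / k)} with hQdef
  obtain ⟨p, -, hp⟩ := Finset.exists_le_card_fiber_of_nsmul_le_card_of_maps_to (s := Q)
    (t := (Finset.univ : Finset (Fin k → Bool))) (f := fun t i => decide (t * y i ∈ A))
    (b := (Fintype.card G : ℝ) / 2 ^ (k + 1)) (fun _ _ => Finset.mem_univ _)
    ⟨fun _ => true, Finset.mem_univ _⟩ (by
      simp only [Finset.card_univ, nsmul_eq_mul, Fintype.card_fun, Fintype.card_fin,
        Fintype.card_bool]
      push_cast
      rw [pow_succ]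
      field_simp
      linarith)
  set B : Finset G := {t ∈ Q | (fun i => decide (t * y i ∈ A)) = p} with hB
  have hBpos : (0 : ℝ) < #B := lt_of_lt_of_le (by positivity) hp
  obtain ⟨T, -, hT, hcov⟩ := Finset.ruzsa_covering_mul (A := (Finset.univ : Finset G)) (B := B)
    (K := 2 ^ (k + 1)) (Finset.card_pos.1 (by exact_mod_cast hBpos)) (by
      rw [div_le_iff₀ (by positivity)] at hp
      have : (#(Finset.univ * B) : ℝ) ≤ Fintype.card G := by exact_mod_cast Finset.card_le_univ _
      linarith)
  refine ⟨T, by exact_mod_cast hT, fun x _ => ?_⟩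
  obtain ⟨f, hf, d, hd, rfl⟩ := Finset.mem_mul.1 (hcov (Finset.mem_univ x))
  obtain ⟨t, ht, t', ht', rfl⟩ := Finset.mem_div.1 hd
  simp only [Set.mem_iUnion]
  refine ⟨f, hf, Set.smul_mem_smul_set ?_⟩
  rw [hB, Finset.mem_filter, hQdef, Finset.mem_filter] at ht ht'
  have hind (i : Fin k) : realIndicator A (t * y i) = realIndicator A (t' * y i) := by
    have h := congrFun (ht.2.trans ht'.2.symm) i
    simp only [decide_eq_decide] at h
    simp [realIndicator, h]
  have hsq : ∑ g, (overlap A (t * g) - overlap A (t' * g)) ^ 2 ≤ 8 * (Fintype.card G / k) := by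
    calc _ ≤ 2 * (D t + D t') := by
          simp only [hD]
          rw [← Finset.sum_add_distrib, Finset.mul_sum]
          refine Finset.sum_le_sum fun g _ => ?_
          simp only [hind]
          set u := (∑ i, realIndicator A (t' * y i) * realIndicator A (g⁻¹ * y i)) / k
          nlinarith [sq_nonneg ((u - overlap A (t * g)) + (u - overlap A (t' * g)))]
      _ ≤ _ := by linarith [ht.1.2, ht'.1.2]
  have hcs := sq_sum_le_card_mul_sum_sq (s := (Finset.univ : Finset G))
    (f := fun g => |overlap A (t * g) - overlap A (t' * g)|)
  simp only [sq_abs, Finset.card_univ] at hcs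
  have hL1 : ∑ g, |overlap A (t * g) - overlap A (t' * g)| ≤ δ * Fintype.card G := by
    refine le_of_sq_le_sq ?_ (by positivity)
    calc _ ≤ _ := hcs
      _ ≤ Fintype.card G * (8 * (Fintype.card G / k)) := by gcongr
      _ = 8 / k * (Fintype.card G : ℝ) ^ 2 := by ring
      _ ≤ δ ^ 2 * (Fintype.card G : ℝ) ^ 2 := by
          gcongr
          rwa [div_le_iff₀ hk']
      _ = _ := by ring
  simp only [almostPeriods, Set.mem_ofPred_eq]
  rw [← Equiv.sum_comp (Equiv.mulLeft t')]
  simpa [div_eq_mul_inv, mul_assoc] using hL1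

lemma le_sum_overlap_of_mul_subset {A : Set G} {c : ℝ} (hc : 0 ≤ c)
    (hA : c * Fintype.card G ≤ A.ncard) {X Y : Finset G}
    (hXY : ∀ y ∈ Y, ∀ y' ∈ Y, y⁻¹ * y' ∈ X) :
    c ^ 2 * #Y ≤ ∑ t ∈ X, overlap A t := by
  classical
  have hN := card_pos_real (G := G)
  rcases Y.eq_empty_or_nonempty with rfl | hY
  · simpa using Finset.sum_nonneg fun t _ => overlap_nonneg A t
  have hYpos : (0 : ℝ) < #Y := by exact_mod_cast hY.card_pos
  have hupper : ∑ y ∈ Y, ∑ y' ∈ Y, overlap A (y⁻¹ * y') ≤ #Y * ∑ t ∈ X, overlap A t := by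
    rw [← nsmul_eq_mul]
    refine Finset.sum_le_card_nsmul _ _ _ fun y hy => ?_
    rw [← Finset.sum_image (s := Y) (g := fun y' => y⁻¹ * y') (f := overlap A)
      (mul_right_injective y⁻¹).injOn]
    refine Finset.sum_le_sum_of_subset_of_nonneg ?_ fun t _ _ => overlap_nonneg A t
    exact Finset.image_subset_iff.2 fun y' hy' => hXY y hy y' hy'
  have hexpand : ∑ y ∈ Y, ∑ y' ∈ Y, overlap A (y⁻¹ * y') =
      (∑ x, (∑ y ∈ Y, realIndicator A (y⁻¹ * x)) ^ 2) / Fintype.card G := by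
    simp_rw [overlap_mul_eq, ← Finset.sum_div]
    congr 1
    simp_rw [sq, Finset.sum_mul_sum]
    rw [Finset.sum_comm (s := Finset.univ)]
    refine Finset.sum_congr rfl fun y _ => ?_
    rw [Finset.sum_comm]
  have hmass : ∑ x, ∑ y ∈ Y, realIndicator A (y⁻¹ * x) = #Y * A.ncard := by
    rw [Finset.sum_comm, ← nsmul_eq_mul]
    refine Finset.sum_eq_card_nsmul fun y _ => ?_
    rw [← sum_realIndicator A]
    exact Equiv.sum_comp (Equiv.mulLeft y⁻¹) _
  have hcs := sq_sum_le_card_mul_sum_sq (s := (Finset.univ : Finset G))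
    (f := fun x => ∑ y ∈ Y, realIndicator A (y⁻¹ * x))
  rw [hmass, Finset.card_univ] at hcs
  have hlow : (#Y * (c * Fintype.card G)) ^ 2 ≤ (#Y * A.ncard : ℝ) ^ 2 := by gcongr
  rw [hexpand, div_le_iff₀ hN] at hupper
  have hfinal : (#Y * (Fintype.card G : ℝ) ^ 2) * (c ^ 2 * #Y) ≤
      (#Y * (Fintype.card G : ℝ) ^ 2) * ∑ t ∈ X, overlap A t := by
    calc _ = (#Y * (c * Fintype.card G)) ^ 2 := by ring
      _ ≤ Fintype.card G * _ := hlow.trans hcs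
      _ ≤ Fintype.card G * _ := mul_le_mul_of_nonneg_left hupper hN.le
      _ = _ := by ring
  exact le_of_mul_le_mul_left hfinal (by positivity)

/-- If the almost periods are dense then almost all of them are quotients of elements of `A`. -/
lemma ncard_almostPeriods_diff_le {A : Set G} {c κ : ℝ} (hc : 0 ≤ c) (hκ : 0 ≤ κ)
    (hA : c * Fintype.card G ≤ A.ncard) :
    ((almostPeriods A κ \ (A * A⁻¹)).ncard : ℝ) * (c ^ 2 * (almostPeriods A (κ / 2)).ncard) ≤
      2 * κ * (Fintype.card G : ℝ) ^ 2 := by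
  classical
  have hN := card_pos_real (G := G)
  set X := (almostPeriods A κ).toFinset
  set Z := (almostPeriods A κ \ (A * A⁻¹)).toFinset with hZ
  rw [Set.ncard_eq_toFinset_card', Set.ncard_eq_toFinset_card']
  have hlow := le_sum_overlap_of_mul_subset hc hA (X := X)
    (Y := (almostPeriods A (κ / 2)).toFinset) (fun y hy y' hy' => by
      rw [Set.mem_toFinset] at hy hy' ⊢
      have := mul_mem_almostPeriods (inv_mem_almostPeriods hy) hy'
      rwa [add_halves] at this)
  have hcard (S : Finset G) : (#S : ℝ) ≤ Fintype.card G := by exact_mod_cast Finset.card_le_univ S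
  have hκN : 0 ≤ κ * Fintype.card G := by positivity
  calc (#Z : ℝ) * _ ≤ #Z * ∑ t ∈ X, overlap A t :=
        mul_le_mul_of_nonneg_left hlow (Nat.cast_nonneg _)
    _ = ∑ _g ∈ Z, ∑ t ∈ X, overlap A t := by rw [Finset.sum_const, nsmul_eq_mul]
    _ ≤ ∑ g ∈ Z, ∑ t ∈ X, (|overlap A (t * g) - overlap A t| +
          |overlap A (t * g) - overlap A g|) := by
        refine Finset.sum_le_sum fun g hg => Finset.sum_le_sum fun t _ => ?_
        have hg0 : overlap A g = 0 := by
          by_contra h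
          exact (Set.mem_toFinset.1 hg).2 (mem_mul_inv_of_overlap_ne_zero h)
        rw [hg0, sub_zero]
        linarith [neg_abs_le (overlap A (t * g) - overlap A t), le_abs_self (overlap A (t * g))]
    _ = ∑ g ∈ Z, ∑ t ∈ X, |overlap A (t * g) - overlap A t| +
          ∑ t ∈ X, ∑ g ∈ Z, |overlap A (t * g) - overlap A g| := by
        simp_rw [Finset.sum_add_distrib]
        congr 1
        rw [Finset.sum_comm]
    _ ≤ #Z • (κ * Fintype.card G) + #X • (κ * Fintype.card G) := by
        refine add_le_add (Finset.sum_le_card_nsmul _ _ _ fun g hg => ?_)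
          (Finset.sum_le_card_nsmul _ _ _ fun t ht => ?_)
        · exact (Finset.sum_le_sum_of_subset_of_nonneg (Finset.subset_univ _)
            fun _ _ _ => abs_nonneg _).trans
            (sum_abs_overlap_mul_right_sub_le (Set.mem_toFinset.1 hg).1)
        · exact (Finset.sum_le_sum_of_subset_of_nonneg (Finset.subset_univ _)
            fun _ _ _ => abs_nonneg _).trans (show t ∈ almostPeriods A κ from Set.mem_toFinset.1 ht)
    _ ≤ _ := by
        simp only [nsmul_eq_mul]
        nlinarith [mul_le_mul_of_nonneg_right (hcard Z) hκN,
          mul_le_mul_of_nonneg_right (hcard X) hκN]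

lemma almostPeriods_subset {A : Set G} {c κ : ℝ} (hc : 0 ≤ c) (hκ : κ < c ^ 4)
    (hA : c * Fintype.card G ≤ A.ncard) :
    almostPeriods A κ ⊆ (A * A⁻¹) * (A * A⁻¹) := by
  intro t ht
  have hN := card_pos_real (G := G)
  have hpos : 0 < ∑ g, overlap A g * overlap A (t * g) := by
    have h1 : ∑ g, overlap A g ^ 2 - ∑ g, |overlap A (t * g) - overlap A g| ≤
        ∑ g, overlap A g * overlap A (t * g) := by
      rw [← Finset.sum_sub_distrib]
      refine Finset.sum_le_sum fun g _ => ?_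
      nlinarith [mul_nonneg (overlap_nonneg A g)
          (sub_nonneg.2 (neg_le.1 (neg_le_abs (overlap A (t * g) - overlap A g)))),
        mul_nonneg (sub_nonneg.2 (overlap_le_one A g)) (abs_nonneg (overlap A (t * g) - overlap A g))]
    have h2 : ∑ g, |overlap A (t * g) - overlap A g| ≤ κ * Fintype.card G := ht
    nlinarith [le_sum_overlap_sq hc hA, mul_pos (sub_pos.2 hκ) hN]
  obtain ⟨g, -, hg⟩ := Finset.exists_ne_zero_of_sum_ne_zero hpos.ne'
  refine ⟨t * g, mem_mul_inv_of_overlap_ne_zero (right_ne_zero_of_mul hg), g⁻¹,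
    mem_mul_inv_of_overlap_ne_zero ?_, by simp⟩
  rw [overlap_inv]
  exact left_ne_zero_of_mul hg

/-- The weighted number of representations of `x` in `(A * A⁻¹) * A`. -/
noncomputable def tripleCount (A : Set G) (x : G) : ℝ :=
  ∑ a, realIndicator A a * overlap A (x * a⁻¹)

lemma tripleCount_le_card (A : Set G) (x : G) : tripleCount A x ≤ Fintype.card G := by
  calc _ ≤ ∑ _a : G, (1 : ℝ) := Finset.sum_le_sum fun a _ =>
        mul_le_one₀ (realIndicator_le_one _ _) (overlap_nonneg _ _) (overlap_le_one _ _)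
    _ = _ := by simp

lemma sum_tripleCount (A : Set G) :
    ∑ x, realIndicator A x * tripleCount A x = Fintype.card G * ∑ g, overlap A g ^ 2 := by
  have hN := card_pos_real (G := G)
  simp_rw [tripleCount, Finset.mul_sum]
  rw [Finset.sum_comm]
  have h (a : G) : ∑ x, realIndicator A x * (realIndicator A a * overlap A (x * a⁻¹)) =
      ∑ g, overlap A g * (realIndicator A (g * a) * realIndicator A a) := by
    rw [← Equiv.sum_comp (Equiv.mulRight a)]
    refine Finset.sum_congr rfl fun g _ => ?_
    simp only [Equiv.coe_mulRight, mul_inv_cancel_right]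
    ring
  simp_rw [h]
  rw [Finset.sum_comm]
  refine Finset.sum_congr rfl fun g _ => ?_
  rw [← Finset.mul_sum, sq, mul_left_comm]
  congr 1
  rw [overlap, mul_div_cancel₀ _ hN.ne']

lemma mul_mem_of_lt_tripleCount {A : Set G} {κ : ℝ} {t x : G} (ht : t ∈ almostPeriods A κ)
    (hx : κ * Fintype.card G < tripleCount A x) : t * x ∈ A * A⁻¹ * A := by
  have hle : tripleCount A x - tripleCount A (t * x) ≤
      ∑ g, |overlap A (t * g) - overlap A g| := by
    rw [← Equiv.sum_comp ((Equiv.inv G).trans (Equiv.mulLeft x))]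
    rw [tripleCount, tripleCount, ← Finset.sum_sub_distrib]
    refine Finset.sum_le_sum fun a _ => ?_
    simp only [Equiv.trans_apply, Equiv.inv_apply, Equiv.coe_mulLeft]
    rw [← mul_sub, ← mul_assoc t x, abs_sub_comm]
    exact (mul_le_mul_of_nonneg_left (le_abs_self _) (realIndicator_nonneg _ _)).trans
      (mul_le_of_le_one_left (abs_nonneg _) (realIndicator_le_one _ _))
  have hpos : 0 < tripleCount A (t * x) := by
    have : ∑ g, |overlap A (t * g) - overlap A g| ≤ κ * Fintype.card G := ht
    linarith
  obtain ⟨a, -, ha⟩ := Finset.exists_ne_zero_of_sum_ne_zero hpos.ne'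
  exact ⟨t * x * a⁻¹, mem_mul_inv_of_overlap_ne_zero (right_ne_zero_of_mul ha), a,
    mem_of_realIndicator_ne_zero (left_ne_zero_of_mul ha), by simp⟩

lemma le_card_lt_tripleCount {A : Set G} [DecidablePred (· ∈ A)] {c κ : ℝ} (hc : 0 ≤ c)
    (hκ : 0 ≤ κ) (hA : c * Fintype.card G ≤ A.ncard) :
    (c ^ 4 - κ) * Fintype.card G ≤ #{x | x ∈ A ∧ κ * Fintype.card G < tripleCount A x} := by
  classical
  have hN := card_pos_real (G := G)
  set S : Finset G := {x | x ∈ A ∧ κ * Fintype.card G < tripleCount A x} with hS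
  have h : ∑ x, realIndicator A x * tripleCount A x ≤
      ∑ x, (κ * Fintype.card G + if x ∈ S then (Fintype.card G : ℝ) else 0) := by
    refine Finset.sum_le_sum fun x _ => ?_
    have hκN : 0 ≤ κ * Fintype.card G := by positivity
    by_cases hx : x ∈ A
    · rw [realIndicator, if_pos hx, one_mul]
      split_ifs with hxS
      · linarith [tripleCount_le_card A x]
      · simp only [hS, Finset.mem_filter, Finset.mem_univ, true_and, hx, not_lt] at hxS
        linarith
    · rw [realIndicator, if_neg hx, zero_mul]
      split_ifs <;> linarith
  rw [sum_tripleCount, Finset.sum_add_distrib, ← Finset.sum_filter] at h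
  simp only [Finset.sum_const, Finset.card_univ, nsmul_eq_mul, Finset.filter_mem_eq_inter,
    Finset.univ_inter] at h
  have h2 := mul_le_mul_of_nonneg_left (le_sum_overlap_sq hc hA) hN.le
  refine le_of_mul_le_mul_left ?_ hN
  linarith

/-- A set meets some right translate, centred at one of its points, of a covering set in a
proportion of its elements. -/
lemma exists_mem_le_card_mul {S T : Finset G} {W : Set G} {b : ℝ} (hb : 0 < b)
    (hcov : (Set.univ : Set G) ⊆ ⋃ g ∈ T, g • W) (hS : #T * b ≤ #S) :
    ∃ x ∈ S, b ≤ ((((W⁻¹ * W) * {x}) ∩ S : Set G).ncard : ℝ) := by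
  classical
  have hex (x : G) : ∃ g ∈ T, x⁻¹ ∈ g • W := by simpa using hcov (Set.mem_univ x⁻¹)
  choose φ hφT hφ using hex
  obtain ⟨g, -, hg⟩ := Finset.exists_le_card_fiber_of_nsmul_le_card_of_maps_to (s := S) (t := T)
    (f := φ) (b := b) (fun x _ => hφT x) ⟨φ 1, hφT 1⟩ (by rwa [nsmul_eq_mul])
  have hpos : (0 : ℝ) < #{x ∈ S | φ x = g} := hb.trans_le hg
  obtain ⟨x, hx⟩ := Finset.card_pos.1 (by exact_mod_cast hpos)
  rw [Finset.mem_filter] at hx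
  refine ⟨x, hx.1, hg.trans ?_⟩
  rw [← Set.ncard_coe_finset]
  refine Nat.cast_le.2 (Set.ncard_le_ncard (fun z hz => ?_) (Set.toFinite _))
  rw [Finset.mem_coe, Finset.mem_filter] at hz
  refine ⟨⟨z * x⁻¹, ?_, x, rfl, by simp⟩, hz.1⟩
  obtain ⟨w, hw, hwx⟩ := hx.2 ▸ hφ x
  obtain ⟨v, hv, hvz⟩ := hz.2 ▸ hφ z
  refine ⟨v⁻¹, Set.inv_mem_inv.2 hv, w, hw, ?_⟩
  simp only [smul_eq_mul] at hwx hvz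
  rw [← hwx, ← inv_inv z, ← hvz]
  group

end AlmostPeriods

theorem stmt_1 (c ε : ℝ) (hc : 0 < c) (hε : 0 < ε) (m : ℕ) (hm : 1 ≤ m) :
    ∃ (k : ℕ) (η : ℝ), 0 < k ∧ 0 < η ∧
      ∀ (G : Type) [Group G] [Fintype G] (A : Set G),
        ProductFree A → c * (Fintype.card G : ℝ) ≤ (A.ncard : ℝ) →
        ∃ X : ℕ → Set G,
          (∀ i, 1 ≤ i → i ≤ m → (X i)⁻¹ = X i ∧ (1 : G) ∈ X i) ∧
          (∀ i, 1 ≤ i → i < m → X (i + 1) ⊆ X i ∧ X (i + 1) * X (i + 1) ⊆ X i) ∧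
          X 1 ⊆ (A * A⁻¹) * (A * A⁻¹) ∧
          (∃ T : Finset G, T.card ≤ k ∧ (Set.univ : Set G) ⊆ ⋃ g ∈ T, g • X m) ∧
          ((X 1 \ (A * A⁻¹)).ncard : ℝ) < ε * (Fintype.card G : ℝ) ∧
          ∃ x ∈ A, X 1 * {x} ⊆ A * A⁻¹ * A ∧
            η * (Fintype.card G : ℝ) ≤ (((X m * {x}) ∩ A).ncard : ℝ) := by
  obtain ⟨κ, hκ, hκc, hκε⟩ : ∃ κ : ℝ, 0 < κ ∧ κ ≤ c ^ 4 / 2 ∧ κ ≤ c ^ 2 * ε ^ 2 / 4 :=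
    ⟨min (c ^ 4 / 2) (c ^ 2 * ε ^ 2 / 4), by positivity, min_le_left _ _, min_le_right _ _⟩
  have hc4 : 0 < c ^ 4 := by positivity
  obtain ⟨k, hk⟩ := exists_nat_ge (8 / (κ / 2 ^ (m + 1)) ^ 2)
  rw [div_le_iff₀' (by positivity)] at hk
  refine ⟨2 ^ (k + 1), c ^ 4 / 2 / 2 ^ (k + 1), by positivity, by positivity,
    fun G _ _ A _ hA => ?_⟩
  classical
  have hN := card_pos_real (G := G)
  obtain ⟨δ, hδ, hδκ, hdiff⟩ : ∃ δ, κ ≤ δ ∧ δ / 2 ≤ κ ∧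
      ((almostPeriods A (δ / 2) \ (A * A⁻¹)).ncard : ℝ) < ε * (Fintype.card G : ℝ) := by
    by_cases hsmall : ((almostPeriods A (κ / 2)).ncard : ℝ) < ε * Fintype.card G
    · refine ⟨κ, le_rfl, by linarith, lt_of_le_of_lt ?_ hsmall⟩
      exact_mod_cast Set.ncard_le_ncard Set.sdiff_subset (Set.toFinite _)
    · refine ⟨2 * κ, by linarith, by linarith, ?_⟩
      rw [mul_div_cancel_left₀ _ two_ne_zero]
      have h := ncard_almostPeriods_diff_le hc.le hκ.le hA
      by_contra! hbig
      have h1 : (ε * Fintype.card G) * (c ^ 2 * (ε * Fintype.card G)) ≤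
          2 * κ * (Fintype.card G : ℝ) ^ 2 := by
        refine le_trans ?_ h
        gcongr
        exact not_lt.1 hsmall
      have h2 : 2 * κ * (Fintype.card G : ℝ) ^ 2 ≤
          2 * (c ^ 2 * ε ^ 2 / 4) * (Fintype.card G : ℝ) ^ 2 := by gcongr
      have h3 : 0 < c ^ 2 * ε ^ 2 * (Fintype.card G : ℝ) ^ 2 := by positivity
      linarith
  have hδpos : 0 < δ := hκ.trans_le hδ
  have hscale (i : ℕ) : δ / 2 ^ (i + 1) + δ / 2 ^ (i + 1) = δ / 2 ^ i := by
    rw [pow_succ]; field_simp; ring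
  obtain ⟨T, hT, hcov⟩ := exists_cover_almostPeriods A (δ := κ / 2 ^ (m + 1)) (by positivity) hk
  have hsub : almostPeriods A (κ / 2 ^ (m + 1)) ⊆ almostPeriods A (δ / 2 ^ m) := by
    refine almostPeriods_mono A (div_le_div₀ hδpos.le hδ (by positivity) ?_)
    exact pow_le_pow_right₀ one_le_two (Nat.le_succ m)
  have hX1 : almostPeriods A (δ / 2 ^ 1) ⊆ almostPeriods A κ :=
    almostPeriods_mono A (by simpa using hδκ)
  have hgood := le_card_lt_tripleCount (κ := κ) hc.le hκ.le hA
  obtain ⟨x, hx, hxcard⟩ := exists_mem_le_card_mul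
    (S := {x | x ∈ A ∧ κ * Fintype.card G < tripleCount A x})
    (b := c ^ 4 / 2 / 2 ^ (k + 1) * Fintype.card G) (by positivity) hcov (by
      refine le_trans ?_ hgood
      calc _ ≤ (2 : ℝ) ^ (k + 1) * (c ^ 4 / 2 / 2 ^ (k + 1) * Fintype.card G) := by
            gcongr; exact_mod_cast hT
        _ = c ^ 4 / 2 * Fintype.card G := by field_simp
        _ ≤ _ := by gcongr; linarith)
  rw [Finset.mem_filter] at hx
  refine ⟨fun i => almostPeriods A (δ / 2 ^ i),
    fun i _ _ => ⟨inv_almostPeriods _ _, one_mem_almostPeriods _ (by positivity)⟩,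
    fun i _ _ => ⟨almostPeriods_mono A ?_, ?_⟩,
    hX1.trans (almostPeriods_subset hc.le (by linarith) hA),
    ⟨T, hT, hcov.trans (Set.iUnion₂_mono fun g _ => Set.smul_set_mono hsub)⟩,
    by simpa using hdiff, x, hx.2.1, ?_, hxcard.trans ?_⟩
  · rw [← hscale i]
    linarith [show 0 < δ / 2 ^ (i + 1) by positivity]
  · rintro _ ⟨s, hs, t, ht, rfl⟩
    simp only [← hscale i]
    exact mul_mem_almostPeriods hs ht
  · rintro _ ⟨t, ht, _, rfl, rfl⟩
    exact mul_mem_of_lt_tripleCount (hX1 ht) hx.2.2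
  · refine Nat.cast_le.2 (Set.ncard_le_ncard (Set.inter_subset_inter
      (Set.mul_subset_mul_right ?_) fun z hz => ?_) (Set.toFinite _))
    · rw [inv_almostPeriods]
      rintro _ ⟨s, hs, t, ht, rfl⟩
      refine almostPeriods_mono A ?_ (mul_mem_almostPeriods hs ht)
      rw [← hscale m]
      gcongr
    · exact (Finset.mem_filter.1 hz).2.1
end

section
/- For every real number c > 0 and every integer r ≥ 1, there exists a positive integer k = k(c, r) such that the following holds. If G is a finite group of order n and exponent r (that is, x^r = 1 for all x ∈ G) and A is a product-free subset of G with |A| ≥ c·n, then there is a proper subgroup H of G of index at most k which is contained in (AA⁻¹)². -/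
open Pointwise

lemma isometry_eq_self_of_pow_eq_one {E : Type*} [NormedAddCommGroup E] [NormedSpace ℝ E]
    (R : E ≃ₗᵢ[ℝ] E) (V : Submodule ℝ E) (hRV : ∀ v ∈ V, R v ∈ V) {r : ℕ} (hr : 1 ≤ r)
    (hR : R ^ r = 1) {θ : ℝ} (hθ : r * θ < 1) (hclose : ∀ v ∈ V, ‖R v - v‖ ≤ θ * ‖v‖)
    {v : E} (hv : v ∈ V) : R v = v := by
  set u := R v - v with hu
  have huV : u ∈ V := V.sub_mem (hRV v hv) hv
  have hpow : ∀ (i : ℕ) (w : E), (R ^ (i + 1)) w = (R ^ i) (R w) := fun i w => by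
    rw [pow_succ]; rfl
  have hnear : ∀ i : ℕ, ‖(R ^ i) u - u‖ ≤ i * (θ * ‖u‖) := by
    intro i
    induction i with
    | zero => simp
    | succ i ih =>
      have h1 : ‖(R ^ (i + 1)) u - (R ^ i) u‖ ≤ θ * ‖u‖ := by
        rw [hpow, ← map_sub, LinearIsometryEquiv.norm_map]
        exact hclose u huV
      calc ‖(R ^ (i + 1)) u - u‖
          = ‖((R ^ (i + 1)) u - (R ^ i) u) + ((R ^ i) u - u)‖ := by congr 1; abel
        _ ≤ θ * ‖u‖ + i * (θ * ‖u‖) := (norm_add_le _ _).trans (add_le_add h1 ih)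
        _ = _ := by push_cast; ring
  have hsum : ∑ i ∈ Finset.range r, (R ^ i) u = 0 := by
    have : ∀ i ∈ Finset.range r, (R ^ i) u = (R ^ (i + 1)) v - (R ^ i) v := fun i _ => by
      rw [hpow, ← map_sub]
    rw [Finset.sum_congr rfl this, Finset.sum_range_sub (fun i => (R ^ i) v), hR]
    simp
  have hbound : (r : ℝ) * ‖u‖ ≤ r * (r * (θ * ‖u‖)) := by
    have hθu : 0 ≤ θ * ‖u‖ := (norm_nonneg _).trans (hclose u huV)
    calc (r : ℝ) * ‖u‖ = ‖∑ i ∈ Finset.range r, ((R ^ i) u - u)‖ := by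
          rw [Finset.sum_sub_distrib, hsum]
          simp [norm_smul, ← Nat.cast_smul_eq_nsmul ℝ]
      _ ≤ ∑ i ∈ Finset.range r, ‖(R ^ i) u - u‖ := norm_sum_le _ _
      _ ≤ ∑ i ∈ Finset.range r, (r : ℝ) * (θ * ‖u‖) := by
          refine Finset.sum_le_sum fun i hi => (hnear i).trans ?_
          have : (i : ℝ) ≤ r := by exact_mod_cast (Finset.mem_range.1 hi).le
          gcongr
      _ = _ := by simp
  have hr0 : (0 : ℝ) < r := by exact_mod_cast hr
  have h2 : ‖u‖ ≤ r * (θ * ‖u‖) := le_of_mul_le_mul_left hbound hr0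
  have h3 : ‖u‖ = 0 := by nlinarith [norm_nonneg u]
  exact sub_eq_zero.1 (norm_eq_zero.1 h3)

lemma Subgroup.index_le_of_fiber {G T : Type*} [Group G] [Fintype T] (H : Subgroup G) (f : G → T)
    (hf : ∀ x y, f x = f y → x⁻¹ * y ∈ H) : H.index ≤ Fintype.card T := by
  rw [Subgroup.index, ← Nat.card_eq_fintype_card]
  refine Nat.card_le_card_of_injective (fun q : G ⧸ H => f q.out) fun p q hpq => ?_
  rw [← QuotientGroup.out_eq' p, ← QuotientGroup.out_eq' q]
  exact QuotientGroup.eq.2 (hf _ _ hpq)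

/-- The elements of `G` that fix `V` pointwise. -/
def pointwiseFixer {G E : Type*} [Group G] [NormedAddCommGroup E] [NormedSpace ℝ E]
    (ρ : G →* (E ≃ₗᵢ[ℝ] E)) (V : Submodule ℝ E) : Subgroup G where
  carrier := {x | ∀ v ∈ V, ρ x v = v}
  one_mem' := fun v _ => by simp
  mul_mem' := fun {x y} hx hy v hv => by
    rw [map_mul]
    exact (congrArg (ρ x) (hy v hv)).trans (hx v hv)
  inv_mem' := fun {x} hx v hv => by
    rw [map_inv, LinearIsometryEquiv.inv_def, LinearIsometryEquiv.symm_apply_eq, hx v hv]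

lemma index_pointwiseFixer_le {G E : Type*} [Group G] [NormedAddCommGroup E]
    [InnerProductSpace ℝ E] [FiniteDimensional ℝ E]
    (ρ : G →* (E ≃ₗᵢ[ℝ] E)) (V : Submodule ℝ E) (hV : ∀ x, ∀ v ∈ V, ρ x v ∈ V)
    {r D : ℕ} (hr : 1 ≤ r) (hexp : ∀ x : G, x ^ r = 1) (hD : Module.finrank ℝ V ≤ D) :
    (pointwiseFixer ρ V).index ≤ (2 * (r * D ^ 2 + 1) + 1) ^ D ^ 2 := by
  set M : ℕ := r * D ^ 2 + 1 with hM
  have hM0 : (0 : ℝ) < M := by positivity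
  set d := Module.finrank ℝ V with hd
  let b := stdOrthonormalBasis ℝ V
  let e : G → Fin d → Fin d → ℝ := fun x i j => inner ℝ (b i : E) (ρ x (b j))
  have hb1 : ∀ i, ‖(b i : E)‖ = 1 := fun i => b.norm_eq_one i
  have he : ∀ x i j, |e x i j| ≤ 1 := fun x i j => by
    have := abs_real_inner_le_norm (b i : E) (ρ x (b j))
    rwa [LinearIsometryEquiv.norm_map, hb1, hb1, mul_one] at this
  let f : G → Fin d → Fin d → Finset.Icc (-(M : ℤ)) M := fun x i j =>
    ⟨⌊e x i j * M⌋, by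
      have h := abs_le.1 (he x i j)
      rw [Finset.mem_Icc]
      constructor
      · rw [Int.le_floor]; push_cast; nlinarith
      · have : (⌊e x i j * M⌋ : ℝ) ≤ M := (Int.floor_le _).trans (by nlinarith)
        exact_mod_cast this⟩
  have hcard : Fintype.card (Fin d → Fin d → Finset.Icc (-(M : ℤ)) M) = (2 * M + 1) ^ (d * d) := by
    have : (M + 1 + M : ℤ).toNat = 2 * M + 1 := by omega
    simp [this, pow_mul]
  refine (Subgroup.index_le_of_fiber _ f fun x y hxy => ?_).trans (hcard.le.trans ?_)
  swap
  · refine Nat.pow_le_pow_right (by omega) ?_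
    rw [sq]; exact Nat.mul_le_mul hD hD
  have hdiff : ∀ i j, |e x i j - e y i j| ≤ 1 / M := fun i j => by
    have h1 : ⌊e x i j * M⌋ = ⌊e y i j * M⌋ :=
      congrArg Subtype.val (congrFun (congrFun hxy i) j)
    have h2 := Int.abs_sub_lt_one_of_floor_eq_floor h1
    rw [← sub_mul, abs_mul, abs_of_pos hM0] at h2
    rw [le_div_iff₀ hM0]; exact h2.le
  have hclose : ∀ v ∈ V, ‖ρ (x⁻¹ * y) v - v‖ ≤ (d ^ 2 / M : ℝ) * ‖v‖ := by
    intro v hv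
    have hnorm : ‖ρ (x⁻¹ * y) v - v‖ = ‖ρ x v - ρ y v‖ := by
      have hxy' : ρ x (ρ (x⁻¹ * y) v) = ρ y v := by
        conv_rhs => rw [← mul_inv_cancel_left x y, map_mul]
        rfl
      rw [← LinearIsometryEquiv.norm_map (ρ x), map_sub, hxy', norm_sub_rev]
    rw [hnorm]
    let w : V := ⟨ρ x v - ρ y v, V.sub_mem (hV x v hv) (hV y v hv)⟩
    let v' : V := ⟨v, hv⟩
    have hv' : v = ∑ j, (inner ℝ (b j) v') • (b j : E) := by
      have := congrArg (Subtype.val) (b.sum_repr' v')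
      simpa using this.symm
    have hcoord : ∀ i, |inner ℝ (b i) w| ≤ d * (1 / M * ‖v‖) := by
      intro i
      have h1 : inner ℝ (b i) w = ∑ j, inner ℝ (b j) v' * (e x i j - e y i j) := by
        have : inner ℝ (b i) w = inner ℝ (b i : E) (ρ x v - ρ y v) := rfl
        clear_value v'
        subst hv'
        rw [this, map_sum, map_sum, ← Finset.sum_sub_distrib, inner_sum]
        refine Finset.sum_congr rfl fun j _ => ?_
        rw [map_smul, map_smul, ← smul_sub, inner_smul_right, inner_sub_right]
      rw [h1]
      refine (Finset.abs_sum_le_sum_abs _ _).trans ?_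
      calc ∑ j, |inner ℝ (b j) v' * (e x i j - e y i j)| ≤ ∑ j : Fin d, 1 / M * ‖v‖ := by
            refine Finset.sum_le_sum fun j _ => ?_
            rw [abs_mul, mul_comm]
            refine mul_le_mul (hdiff i j) ?_ (abs_nonneg _) (by positivity)
            have := abs_real_inner_le_norm (b j) v'
            rwa [b.norm_eq_one, one_mul] at this
        _ = _ := by simp
    have h2 : ‖w‖ ≤ ∑ i, |inner ℝ (b i) w| := by
      conv_lhs => rw [← b.sum_repr' w]
      refine (norm_sum_le _ _).trans (Finset.sum_le_sum fun i _ => ?_)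
      rw [norm_smul, b.norm_eq_one, mul_one, Real.norm_eq_abs]
    calc ‖ρ x v - ρ y v‖ = ‖w‖ := rfl
      _ ≤ ∑ i, |inner ℝ (b i) w| := h2
      _ ≤ ∑ i : Fin d, d * (1 / M * ‖v‖) := Finset.sum_le_sum fun i _ => hcoord i
      _ = _ := by simp; ring
  intro v hv
  refine isometry_eq_self_of_pow_eq_one (ρ (x⁻¹ * y)) V (hV _) hr (by rw [← map_pow, hexp, map_one])
    ?_ hclose hv
  rw [mul_div_assoc', div_lt_one hM0]
  have : r * d ^ 2 < M := by
    have := Nat.mul_le_mul_left r (Nat.pow_le_pow_left hD 2)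
    omega
  exact_mod_cast this

lemma exists_spectral_submodule {E : Type*} [NormedAddCommGroup E] [InnerProductSpace ℝ E]
    [FiniteDimensional ℝ E] (S : E →ₗ[ℝ] E) (hS : S.IsPositive) {ε : ℝ} (hε : 0 ≤ ε) :
    ∃ V : Submodule ℝ E,
      (∀ R : E →ₗ[ℝ] E, (∀ v, R (S v) = S (R v)) → ∀ v ∈ V, R v ∈ V) ∧
      ε * Module.finrank ℝ V ≤ LinearMap.trace ℝ E S ∧
      (∀ w ∈ Vᗮ, inner ℝ (S w) w ≤ ε * ‖w‖ ^ 2) ∧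
      (∀ w ∈ Vᗮ, ‖S w‖ ^ 2 ≤ ε * inner ℝ (S w) w) := by
  classical
  have hsym := hS.isSymmetric
  set l := hsym.eigenvalues rfl
  set b := hsym.eigenvectorBasis rfl
  have hb : ∀ i, S (b i) = l i • b i := fun i => hsym.apply_eigenvectorBasis rfl i
  have hl : ∀ i, 0 ≤ l i := fun i => hS.nonneg_eigenvalues rfl i
  have hcoef : ∀ v i, inner ℝ (b i) (S v) = l i * inner ℝ (b i) v := fun v i => by
    rw [← hsym, hb, inner_smul_left]; rfl
  refine ⟨Submodule.span ℝ (b '' {i | ε ≤ l i}), ?_, ?_, ?_⟩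
  · intro R hR v hv
    induction hv using Submodule.span_induction with
    | zero => simp
    | add x y _ _ hx hy => rw [map_add]; exact add_mem hx hy
    | smul a x _ hx => rw [map_smul]; exact Submodule.smul_mem _ _ hx
    | mem x hx =>
      obtain ⟨i, hi, rfl⟩ := hx
      rw [← b.sum_repr' (R (b i))]
      refine Submodule.sum_mem _ fun j _ => ?_
      by_cases hj : ε ≤ l j
      · exact Submodule.smul_mem _ _ (Submodule.subset_span ⟨j, hj, rfl⟩)
      · have h1 : l i * inner ℝ (b j) (R (b i)) = l j * inner ℝ (b j) (R (b i)) := by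
          rw [← hcoef, ← hR, hb, map_smul, inner_smul_right]
        have h2 : inner ℝ (b j) (R (b i)) = 0 := by
          by_contra h
          exact hj (mul_right_cancel₀ h h1 ▸ hi)
        rw [h2, zero_smul]; exact zero_mem _
  · have hrank : Module.finrank ℝ (Submodule.span ℝ (b '' {i | ε ≤ l i}))
        ≤ (Finset.univ.filter fun i => ε ≤ l i).card := by
      have h := finrank_span_finset_le_card (R := ℝ)
        ((Finset.univ.filter fun i => ε ≤ l i).image b)
      rw [Finset.coe_image, Finset.coe_filter_univ] at h
      exact h.trans Finset.card_image_le
    rw [LinearMap.trace_eq_sum_inner S b]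
    refine (mul_le_mul_of_nonneg_left (Nat.cast_le.2 hrank) hε).trans ?_
    calc ε * ((Finset.univ.filter fun i => ε ≤ l i).card : ℝ)
        = ∑ i ∈ Finset.univ.filter fun i => ε ≤ l i, ε := by simp [mul_comm]
      _ ≤ ∑ i ∈ Finset.univ.filter fun i => ε ≤ l i, l i :=
          Finset.sum_le_sum fun i hi => (Finset.mem_filter.1 hi).2
      _ ≤ ∑ i, l i := Finset.sum_le_sum_of_subset_of_nonneg (Finset.filter_subset _ _)
          fun i _ _ => hl i
      _ = _ := Finset.sum_congr rfl fun i _ => by rw [hcoef]; simp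
  · have horth : ∀ w ∈ (Submodule.span ℝ (b '' {i | ε ≤ l i}))ᗮ, ∀ i, l i ≤ ε ∨ inner ℝ (b i) w = 0 := by
      intro w hw i
      by_cases hi : ε ≤ l i
      · exact Or.inr (hw _ (Submodule.subset_span ⟨i, hi, rfl⟩))
      · exact Or.inl (not_le.1 hi).le
    have hinner : ∀ w, inner ℝ (S w) w = ∑ i, l i * inner ℝ (b i) w ^ 2 := fun w => by
      rw [← b.sum_inner_mul_inner]
      refine Finset.sum_congr rfl fun i _ => ?_
      rw [real_inner_comm, hcoef]; ring
    refine ⟨fun w hw => ?_, fun w hw => ?_⟩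
    · rw [hinner, ← b.sum_sq_inner_right, Finset.mul_sum]
      refine Finset.sum_le_sum fun i _ => ?_
      rcases horth w hw i with h | h
      · gcongr
      · simp [h]
    · rw [hinner, ← b.sum_sq_inner_right, Finset.mul_sum]
      refine Finset.sum_le_sum fun i _ => ?_
      rw [hcoef]
      rcases horth w hw i with h | h
      · have : 0 ≤ l i * inner ℝ (b i) w ^ 2 := mul_nonneg (hl i) (sq_nonneg _)
        nlinarith
      · simp [h]

lemma inner_apply_apply_pos {E : Type*} [NormedAddCommGroup E] [InnerProductSpace ℝ E]
    [FiniteDimensional ℝ E] {S : E →ₗ[ℝ] E} (hS : S.IsPositive) {R : E ≃ₗᵢ[ℝ] E}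
    (hcomm : ∀ v, R (S v) = S (R v)) {V : Submodule ℝ E} (hSV : ∀ v ∈ V, S v ∈ V)
    (hRV : ∀ v ∈ V, R v = v) {ε : ℝ} (hε : 0 ≤ ε)
    (hV : ∀ w ∈ Vᗮ, ‖S w‖ ^ 2 ≤ ε * inner ℝ (S w) w) {f : E}
    (hf : 2 * ε * inner ℝ (S f) f < ‖S f‖ ^ 2) : 0 < inner ℝ (S f) (S (R f)) := by
  obtain ⟨u, hu, w, hw, rfl⟩ := V.exists_add_mem_mem_orthogonal f
  have hSw : S w ∈ Vᗮ := fun v hv => by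
    rw [← hS.isSymmetric]; exact hw _ (hSV v hv)
  have hRSw : R (S w) ∈ Vᗮ := fun v hv => by
    rw [← hRV v hv, LinearIsometryEquiv.inner_map_map]; exact hSw v hv
  have hSu := hSV u hu
  have e1 : inner ℝ (S u) (S w) = 0 := hSw _ hSu
  have e2 : inner ℝ (S u) (R (S w)) = 0 := hRSw _ hSu
  have e3 : inner ℝ (S w) (S u) = 0 := by rw [real_inner_comm]; exact e1
  have e4 : inner ℝ (S u) w = 0 := hw _ hSu
  have e5 : inner ℝ (S w) u = 0 := by rw [real_inner_comm]; exact hSw _ hu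
  have h1 := hV w hw
  have h2 : 0 ≤ inner ℝ (S u) u := hS.2 u
  have h3 : -‖S w‖ ^ 2 ≤ inner ℝ (S w) (R (S w)) := by
    have := abs_le.1 (abs_real_inner_le_norm (S w) (R (S w)))
    rw [LinearIsometryEquiv.norm_map] at this
    linarith [this.1]
  rw [← hcomm, map_add, map_add, hRV _ hSu]
  rw [map_add, ← real_inner_self_eq_norm_sq] at hf
  simp only [inner_add_left, inner_add_right, e1, e2, e3, e4, e5, real_inner_self_eq_norm_sq,
    add_zero, zero_add] at hf ⊢
  nlinarith [mul_nonneg hε h2]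

/-- The right regular representation, `f ↦ (y ↦ f (y * x))`. -/
noncomputable def rightRegular (G : Type*) [Group G] [Fintype G] :
    G →* (EuclideanSpace ℝ G ≃ₗᵢ[ℝ] EuclideanSpace ℝ G) where
  toFun x := LinearIsometryEquiv.piLpCongrLeft 2 ℝ ℝ (Equiv.mulRight x⁻¹)
  map_one' := by
    ext f y
    change f (y * 1⁻¹⁻¹) = f y
    simp
  map_mul' x y := by
    ext f z
    change f (z * (x * y)⁻¹⁻¹) = f (z * x⁻¹⁻¹ * y⁻¹⁻¹)
    simp [mul_assoc]

lemma rightRegular_apply {G : Type*} [Group G] [Fintype G] (x : G) (f : EuclideanSpace ℝ G)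
    (y : G) : rightRegular G x f y = f (y * x) := by
  change f (y * x⁻¹⁻¹) = _
  rw [inv_inv]

/-- The operator sending `f` to `y ↦ ∑ a ∈ A, f (a * y)`. -/
noncomputable def translateSum {G : Type*} [Group G] [Fintype G] (A : Finset G) :
    EuclideanSpace ℝ G →ₗ[ℝ] EuclideanSpace ℝ G where
  toFun f := WithLp.toLp 2 fun y => ∑ a ∈ A, f (a * y)
  map_add' f g := by ext y; simp [Finset.sum_add_distrib]
  map_smul' c f := by ext y; simp [Finset.mul_sum]

section

variable {G : Type*} [Group G] [Fintype G] (A : Finset G)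

lemma translateSum_apply (f : EuclideanSpace ℝ G) (y : G) :
    translateSum A f y = ∑ a ∈ A, f (a * y) := rfl

lemma rightRegular_translateSum (x : G) (f : EuclideanSpace ℝ G) :
    rightRegular G x (translateSum A f) = translateSum A (rightRegular G x f) := by
  ext y
  simp [rightRegular_apply, translateSum_apply, mul_assoc]

lemma sum_indicator_mul_inv [DecidableEq G] (z : G) :
    ∑ y, (if z * y⁻¹ ∈ A then (1 : ℝ) else 0) = A.card :=
  (Equiv.sum_comp ((Equiv.inv G).trans (Equiv.mulLeft z))
    fun t => if t ∈ A then (1 : ℝ) else 0).trans (by simp)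

lemma sum_indicator_mul [DecidableEq G] (z : G) :
    ∑ y, (if y * z ∈ A then (1 : ℝ) else 0) = A.card :=
  (Equiv.sum_comp (Equiv.mulRight z) fun t => if t ∈ A then (1 : ℝ) else 0).trans (by simp)

lemma translateSum_single [DecidableEq G] (z y : G) :
    translateSum A (EuclideanSpace.single z 1) y = if z * y⁻¹ ∈ A then 1 else 0 := by
  simp [translateSum_apply, PiLp.single_apply, ← eq_mul_inv_iff_mul_eq]

lemma sum_translateSum (f : EuclideanSpace ℝ G) :
    ∑ y, translateSum A f y = A.card * ∑ y, f y := by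
  simp only [translateSum_apply]
  rw [Finset.sum_comm]
  have : ∀ a ∈ A, ∑ y, f (a * y) = ∑ y, f y := fun a _ =>
    Equiv.sum_comp (Equiv.mulLeft a) fun y => f y
  rw [Finset.sum_congr rfl this]
  simp

/-- The positive operator `translateSumᵀ ∘ translateSum`. -/
noncomputable def translateGram : EuclideanSpace ℝ G →ₗ[ℝ] EuclideanSpace ℝ G :=
  (translateSum A).adjoint ∘ₗ translateSum A

lemma translateGram_isPositive : (translateGram A).IsPositive :=
  LinearMap.isPositive_adjoint_comp_self _

lemma inner_translateGram (f g : EuclideanSpace ℝ G) :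
    inner ℝ (translateGram A f) g = inner ℝ (translateSum A f) (translateSum A g) :=
  LinearMap.adjoint_inner_left (translateSum A) g (translateSum A f)

lemma rightRegular_translateGram (x : G) (f : EuclideanSpace ℝ G) :
    rightRegular G x (translateGram A f) = translateGram A (rightRegular G x f) := by
  refine ext_inner_right ℝ fun g => ?_
  obtain ⟨g, rfl⟩ := (rightRegular G x).surjective g
  rw [LinearIsometryEquiv.inner_map_map, inner_translateGram, inner_translateGram,
    ← rightRegular_translateSum, ← rightRegular_translateSum, LinearIsometryEquiv.inner_map_map]

lemma inner_translateGram_single [DecidableEq G] (z : G) :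
    inner ℝ (translateGram A (EuclideanSpace.single z 1)) (EuclideanSpace.single z 1)
      = (A.card : ℝ) := by
  rw [inner_translateGram, PiLp.inner_apply]
  simp only [translateSum_single]
  have h : ∀ y : G, inner ℝ (if z * y⁻¹ ∈ A then (1 : ℝ) else 0) (if z * y⁻¹ ∈ A then 1 else 0)
      = if z * y⁻¹ ∈ A then (1 : ℝ) else 0 := fun y => by split_ifs <;> simp
  rw [Finset.sum_congr rfl fun y _ => h y, sum_indicator_mul_inv]

lemma trace_translateGram :
    LinearMap.trace ℝ _ (translateGram A) = (Fintype.card G : ℝ) * A.card := by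
  classical
  rw [LinearMap.trace_eq_sum_inner _ (EuclideanSpace.basisFun G ℝ)]
  have : ∀ y : G, inner ℝ (EuclideanSpace.basisFun G ℝ y)
      (translateGram A (EuclideanSpace.basisFun G ℝ y)) = A.card := fun y => by
    rw [real_inner_comm, EuclideanSpace.basisFun_apply, inner_translateGram_single]
  rw [Finset.sum_congr rfl fun y _ => this y]
  simp

lemma translateGram_single_apply [DecidableEq G] (z y : G) :
    translateGram A (EuclideanSpace.single z 1) y
      = ∑ t, if z * t⁻¹ ∈ A ∧ y * t⁻¹ ∈ A then 1 else 0 := by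
  have h : translateGram A (EuclideanSpace.single z 1) y
      = inner ℝ (translateGram A (EuclideanSpace.single z 1)) (EuclideanSpace.single y 1) := by
    simp [EuclideanSpace.inner_single_right]
  rw [h, inner_translateGram, PiLp.inner_apply]
  refine Finset.sum_congr rfl fun t _ => ?_
  simp only [translateSum_single]
  split_ifs <;> simp_all

lemma card_pow_le_norm_translateGram_single [DecidableEq G] (z : G) :
    (A.card : ℝ) ^ 4
      ≤ Fintype.card G * ‖translateGram A (EuclideanSpace.single z 1)‖ ^ 2 := by
  have h : ∑ y, translateGram A (EuclideanSpace.single z 1) y = (A.card : ℝ) ^ 2 := by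
    simp only [translateGram_single_apply]
    rw [Finset.sum_comm]
    have : ∀ t : G, (∑ y, if z * t⁻¹ ∈ A ∧ y * t⁻¹ ∈ A then (1 : ℝ) else 0)
        = A.card * if z * t⁻¹ ∈ A then 1 else 0 := fun t => by
      rw [← sum_indicator_mul A t⁻¹]
      split_ifs with h <;> simp [h]
    rw [Finset.sum_congr rfl fun t _ => this t, ← Finset.mul_sum,
      sum_indicator_mul_inv, sq]
  rw [EuclideanSpace.real_norm_sq_eq]
  have := sq_sum_le_card_mul_sum_sq (s := Finset.univ)
    (f := fun y => translateGram A (EuclideanSpace.single z 1) y)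
  rw [h, Finset.card_univ] at this
  linarith [this]

lemma mem_of_inner_translateGram_pos [DecidableEq G] {x : G}
    (hx : 0 < inner ℝ (translateGram A (EuclideanSpace.single 1 1))
      (translateGram A (rightRegular G x (EuclideanSpace.single 1 1)))) :
    x ∈ ((A : Set G) * (A : Set G)⁻¹) * ((A : Set G) * (A : Set G)⁻¹) := by
  have key : ∀ y, translateGram A (EuclideanSpace.single 1 1) y ≠ 0 →
      y ∈ (A : Set G) * (A : Set G)⁻¹ ∧ y⁻¹ ∈ (A : Set G) * (A : Set G)⁻¹ := by
    intro y hy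
    rw [translateGram_single_apply] at hy
    obtain ⟨t, -, ht⟩ := Finset.exists_ne_zero_of_sum_ne_zero hy
    have ht' : 1 * t⁻¹ ∈ A ∧ y * t⁻¹ ∈ A := by
      by_contra h; exact ht (if_neg h)
    rw [one_mul] at ht'
    exact ⟨⟨_, ht'.2, t, by simpa using ht'.1, by simp⟩,
      ⟨_, ht'.1, t * y⁻¹, by simpa using ht'.2, by simp⟩⟩
  rw [← rightRegular_translateGram, PiLp.inner_apply] at hx
  obtain ⟨y, -, hy⟩ := Finset.exists_ne_zero_of_sum_ne_zero hx.ne'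
  rw [rightRegular_apply] at hy
  have h1 : translateGram A (EuclideanSpace.single 1 1) y ≠ 0 := fun h => hy (by simp [h])
  have h2 : translateGram A (EuclideanSpace.single 1 1) (y * x) ≠ 0 := fun h => hy (by simp [h])
  exact ⟨_, (key _ h1).2, _, (key _ h2).1, by simp⟩

lemma card_pow_le_of_productFree (hA : ProductFree (A : Set G)) {ε : ℝ}
    (hε : ∀ f : EuclideanSpace ℝ G, ∑ y, f y = 0 → ‖translateSum A f‖ ^ 2 ≤ ε * ‖f‖ ^ 2)
    (hε0 : 0 ≤ ε) : (A.card : ℝ) ^ 4 ≤ ε * Fintype.card G ^ 2 := by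
  classical
  set n : ℝ := (Fintype.card G : ℝ) with hn
  set m : ℝ := (A.card : ℝ) with hm
  have hn0 : 0 < n := Nat.cast_pos.2 Fintype.card_pos
  have hm0 : 0 ≤ m := by positivity
  let f : EuclideanSpace ℝ G := WithLp.toLp 2 fun y => (if y ∈ A then 1 else 0) - m / n
  have hfy : ∀ y, f y = (if y ∈ A then 1 else 0) - m / n := fun y => rfl
  have hind : ∑ y : G, (if y ∈ A then (1 : ℝ) else 0) = m := by simp [hm]
  have hsum : ∑ y, f y = 0 := by
    simp only [hfy, Finset.sum_sub_distrib, hind]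
    simp [← hn]; field_simp; simp
  have hnorm : ‖f‖ ^ 2 = m - m ^ 2 / n := by
    rw [EuclideanSpace.real_norm_sq_eq]
    have : ∀ y, f y ^ 2 = (if y ∈ A then (1 : ℝ) else 0) - m / n * (if y ∈ A then (1 : ℝ) else 0)
        - m / n * f y := fun y => by rw [hfy]; split_ifs <;> ring
    rw [Finset.sum_congr rfl fun y _ => this y, Finset.sum_sub_distrib, Finset.sum_sub_distrib,
      ← Finset.mul_sum, ← Finset.mul_sum, hsum, hind]
    ring
  have hzero : ∀ y ∈ A, translateSum A f y = - (m ^ 2 / n) := fun y hy => by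
    rw [translateSum_apply]
    have : ∀ a ∈ A, f (a * y) = - (m / n) := fun a ha => by
      rw [hfy, if_neg (mt Finset.mem_coe.2 (hA a ha y hy)), zero_sub]
    rw [Finset.sum_congr rfl this]
    simp [← hm]; ring
  have hinner : inner ℝ (translateSum A f) f = - (m ^ 3 / n) := by
    rw [PiLp.inner_apply]
    have : ∀ y, inner ℝ (translateSum A f y) (f y) = (- (m ^ 2 / n)) * (if y ∈ A then (1 : ℝ) else 0)
        - m / n * translateSum A f y := fun y => by
      have h : inner ℝ (translateSum A f y) (f y) = f y * translateSum A f y := rfl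
      rw [h]
      by_cases hy : y ∈ A
      · simp only [hfy y, if_pos hy, hzero y hy]; ring
      · simp only [hfy y, if_neg hy]; ring
    rw [Finset.sum_congr rfl fun y _ => this y, Finset.sum_sub_distrib, ← Finset.mul_sum,
      ← Finset.mul_sum, sum_translateSum, hsum, hind]
    ring
  have hcs : (m ^ 3 / n) ^ 2 ≤ ‖translateSum A f‖ ^ 2 * ‖f‖ ^ 2 := by
    have := abs_real_inner_le_norm (translateSum A f) f
    rw [hinner, abs_neg, abs_of_nonneg (by positivity)] at this
    rw [← mul_pow]
    exact pow_le_pow_left₀ (by positivity) this 2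
  have hfm : ‖f‖ ^ 2 ≤ m := by
    rw [hnorm]; have : 0 ≤ m ^ 2 / n := by positivity
    linarith
  have hbound : (m ^ 3 / n) ^ 2 ≤ ε * m ^ 2 := by
    calc (m ^ 3 / n) ^ 2 ≤ (ε * ‖f‖ ^ 2) * ‖f‖ ^ 2 :=
          hcs.trans (mul_le_mul_of_nonneg_right (hε f hsum) (sq_nonneg _))
      _ ≤ (ε * m) * m := by gcongr
      _ = ε * m ^ 2 := by ring
  rcases hm0.eq_or_lt with h0 | h0
  · rw [← h0]; norm_num; positivity
  · rw [div_pow, div_le_iff₀ (by positivity)] at hbound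
    have : m ^ 2 * m ^ 4 ≤ m ^ 2 * (ε * n ^ 2) := by linarith
    exact le_of_mul_le_mul_left this (by positivity)

end

theorem stmt_2 (c : ℝ) (hc : 0 < c) (r : ℕ) (hr : 1 ≤ r) :
    ∃ k : ℕ, 0 < k ∧
      ∀ (G : Type) [Group G] [Fintype G] (A : Set G),
        (∀ x : G, x ^ r = 1) →
        ProductFree A → c * (Fintype.card G : ℝ) ≤ (A.ncard : ℝ) →
        ∃ H : Subgroup G, H ≠ ⊤ ∧ H.index ≤ k ∧
          (H : Set G) ⊆ (A * A⁻¹) * (A * A⁻¹) := by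
  classical
  set D : ℕ := ⌊4 / c ^ 4⌋₊
  refine ⟨(2 * (r * D ^ 2 + 1) + 1) ^ D ^ 2, by positivity, ?_⟩
  intro G _ _ A hexp hA hcard
  obtain ⟨A, rfl⟩ : ∃ B : Finset G, A = B := ⟨A.toFinset, by simp⟩
  rw [Set.ncard_coe_finset] at hcard
  set n : ℝ := (Fintype.card G : ℝ) with hn
  have hn0 : 0 < n := Nat.cast_pos.2 Fintype.card_pos
  have hmn : (A.card : ℝ) ≤ n := Nat.cast_le.2 A.card_le_univ
  set m : ℝ := (A.card : ℝ) with hm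
  have hm0 : 0 < m := lt_of_lt_of_le (by positivity) hcard
  have hc1 : c ≤ 1 := le_of_mul_le_mul_right (by linarith) hn0
  set ε : ℝ := c ^ 4 / 4 * n ^ 2 with hε
  have hε0 : 0 < ε := by positivity
  obtain ⟨V, hinv, hdim, hV1, hV2⟩ :=
    exists_spectral_submodule _ (translateGram_isPositive A) hε0.le
  have hρV : ∀ x, ∀ v ∈ V, rightRegular G x v ∈ V := fun x v hv =>
    hinv ((rightRegular G x).toLinearEquiv : _ →ₗ[ℝ] _)
      (fun v => rightRegular_translateGram A x v) v hv
  have hD : Module.finrank ℝ V ≤ D := by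
    rw [trace_translateGram, ← hn, ← hm] at hdim
    refine Nat.le_floor ?_
    rw [le_div_iff₀ (by positivity)]
    have h : n ^ 2 * (Module.finrank ℝ V * c ^ 4) ≤ n ^ 2 * 4 := by
      nlinarith
    exact le_of_mul_le_mul_left h (by positivity)
  refine ⟨pointwiseFixer (rightRegular G) V, fun htop => ?_,
    index_pointwiseFixer_le _ V hρV hr hexp hD, fun x hx => ?_⟩
  · have hfix : ∀ x : G, ∀ v ∈ V, rightRegular G x v = v := fun x =>
      (htop ▸ Subgroup.mem_top x : x ∈ pointwiseFixer (rightRegular G) V)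
    have hpow := card_pow_le_of_productFree A hA (ε := ε) (fun f hf => ?_) hε0.le
    · have h1 : (c * n) ^ 4 ≤ m ^ 4 := pow_le_pow_left₀ (by positivity) hcard 4
      have h2 : 0 < (c * n) ^ 4 := by positivity
      rw [← hn, ← hm] at hpow
      have h3 : ε * n ^ 2 = (c * n) ^ 4 / 4 := by rw [hε]; ring
      linarith
    · have hfV : f ∈ Vᗮ := fun v hv => by
        have hconst : ∀ y, v y = v 1 := fun y => by
          have := congrArg (fun w : EuclideanSpace ℝ G => w 1) (hfix y v hv)
          simpa [rightRegular_apply] using this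
        rw [PiLp.inner_apply]
        have : ∀ y, inner ℝ (v y) (f y) = v 1 * f y := fun y => by
          rw [hconst y]; exact mul_comm _ _
        rw [Finset.sum_congr rfl fun y _ => this y, ← Finset.mul_sum, hf, mul_zero]
      have := hV1 f hfV
      rwa [inner_translateGram, real_inner_self_eq_norm_sq] at this
  · refine mem_of_inner_translateGram_pos A ?_
    refine inner_apply_apply_pos (translateGram_isPositive A)
      (fun v => rightRegular_translateGram A x v) (hinv _ fun v => rfl) hx hε0.le hV2 ?_
    rw [inner_translateGram_single, ← hm]
    have h := card_pow_le_norm_translateGram_single A (1 : G)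
    rw [← hn, ← hm] at h
    have h1 : (c * n) ^ 3 ≤ m ^ 3 := pow_le_pow_left₀ (by positivity) hcard 3
    have h2 : c ^ 4 ≤ c ^ 3 := pow_le_pow_of_le_one hc.le hc1 (by norm_num)
    have h3 : n * (2 * ε * m) < m ^ 4 := by
      have : c ^ 4 * n ^ 3 ≤ m ^ 3 := by
        refine le_trans ?_ h1
        rw [mul_pow]; gcongr
      calc n * (2 * ε * m) = (c ^ 4 * n ^ 3) / 2 * m := by rw [hε]; ring
        _ ≤ m ^ 3 / 2 * m := by gcongr
        _ < m ^ 4 := by nlinarith [pow_pos hm0 4]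
    exact lt_of_mul_lt_mul_left (h3.trans_le h) hn0.le
end

section
/- For all real numbers c, ε > 0 and every integer m ≥ 1, there exist a positive integer k = k(c, ε, m) and a real number δ = δ(c, ε, m) > 0 such that the following holds. If G is a finite group of order n and exponent m (that is, x^m = 1 for all x ∈ G) and A is a product-free subset of G with |A| ≥ c·n, then there is a normal proper subgroup H of G of index at most k such that: (a) H is contained in (AA⁻¹)² and |H \ AA⁻¹| < ε·n, and (b) some coset C of H is contained in AA⁻¹A and satisfies |C ∩ A| ≥ δ·n. -/
open Pointwise

open scoped InnerProductSpace

/-- A linear map of order dividing `m` that moves no vector by more than `1 / (2 * m)` of its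
length is trivial. -/
theorem eq_one_of_pow_eq_one_of_norm_sub_le {E : Type*} [NormedAddCommGroup E] [NormedSpace ℝ E]
    {m : ℕ} (hm : 1 ≤ m) {f : E →ₗ[ℝ] E} (hf : f ^ m = 1) (hnorm : ∀ v, ‖f v‖ = ‖v‖)
    (hclose : ∀ v, 2 * m * ‖f v - v‖ ≤ ‖v‖) : f = 1 := by
  have hpow : ∀ (j : ℕ) v, 2 * m * ‖(f ^ j) v - v‖ ≤ j * ‖v‖ := by
    intro j v
    induction j with
    | zero => simp
    | succ j ih =>
      have h1 : ‖(f ^ (j + 1)) v - v‖ ≤ ‖f v - v‖ + ‖(f ^ j) v - v‖ := by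
        rw [pow_succ']
        calc ‖f ((f ^ j) v) - v‖ = ‖(f v - v) + f ((f ^ j) v - v)‖ := by
              rw [map_sub]; congr 1; abel
          _ ≤ _ := (norm_add_le _ _).trans (by rw [hnorm ((f ^ j) v - v)])
      have h2 : (2 * m : ℝ) * ‖(f ^ (j + 1)) v - v‖ ≤ 2 * m * (‖f v - v‖ + ‖(f ^ j) v - v‖) := by
        gcongr
      have := hclose v
      push_cast
      nlinarith
  ext v
  set w := f v - v with hw
  have hsum : ∑ j ∈ Finset.range m, (f ^ j) w = 0 := by
    have : ∀ j, (f ^ j) w = (f ^ (j + 1)) v - (f ^ j) v := fun j => by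
      rw [hw, map_sub, pow_succ]; rfl
    simp_rw [this]
    rw [Finset.sum_range_sub (fun j => (f ^ j) v), hf]
    simp
  have hm' : (1 : ℝ) ≤ m := by exact_mod_cast hm
  have h1 : (m : ℝ) • w = -∑ j ∈ Finset.range m, ((f ^ j) w - w) := by
    rw [Finset.sum_sub_distrib, hsum]
    simp [Nat.cast_smul_eq_nsmul]
  have h2 : m * ‖w‖ ≤ ∑ j ∈ Finset.range m, ‖w‖ / 2 := by
    calc m * ‖w‖ = ‖(m : ℝ) • w‖ := by rw [norm_smul]; simp
      _ ≤ ∑ j ∈ Finset.range m, ‖(f ^ j) w - w‖ := by rw [h1, norm_neg]; exact norm_sum_le _ _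
      _ ≤ _ := by
        refine Finset.sum_le_sum fun j hj => ?_
        have hj' : (j : ℝ) ≤ m := by exact_mod_cast (Finset.mem_range.1 hj).le
        have h3 := hpow j w
        have h4 : (j : ℝ) * ‖w‖ ≤ m * ‖w‖ := by gcongr
        have h5 : (m : ℝ) * (2 * ‖(f ^ j) w - w‖) ≤ m * ‖w‖ := by linarith
        have := le_of_mul_le_mul_left h5 (by linarith)
        linarith
  simp only [Finset.sum_const, Finset.card_range, nsmul_eq_mul] at h2
  have : ‖w‖ = 0 := by
    have := norm_nonneg w
    nlinarith
  exact sub_eq_zero.1 (norm_eq_zero.1 this)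

/-- A group of exponent `m` of isometries of a space of dimension at most `D` has order bounded
in terms of `m` and `D`. -/
theorem index_ker_le {G E : Type*} [Group G] [NormedAddCommGroup E] [InnerProductSpace ℝ E]
    [FiniteDimensional ℝ E] {m D : ℕ} (hm : 1 ≤ m) (hG : ∀ x : G, x ^ m = 1)
    (R : G →* (E →ₗ[ℝ] E)) (hR : ∀ g v, ‖R g v‖ = ‖v‖) (hD : Module.finrank ℝ E ≤ D) :
    R.ker.index ≤ (2 * (2 * m * D ^ 2 + 1) + 1) ^ D ^ 2 := by
  set d := Module.finrank ℝ E
  set L : ℕ := 2 * m * D ^ 2 + 1 with hL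
  let b := stdOrthonormalBasis ℝ E
  let cell : G → Fin d × Fin d → ℤ := fun g p => ⌊L * ⟪b p.2, R g (b p.1)⟫_ℝ⌋
  have hcell : ∀ g p, cell g p ∈ Finset.Icc (-(L : ℤ)) L := by
    intro g p
    have h1 : |⟪b p.2, R g (b p.1)⟫_ℝ| ≤ 1 := by
      refine (abs_real_inner_le_norm _ _).trans ?_
      rw [hR, b.norm_eq_one, b.norm_eq_one, one_mul]
    obtain ⟨h2, h3⟩ := abs_le.1 h1
    have hL0 : (0 : ℝ) ≤ L := by positivity
    rw [Finset.mem_Icc]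
    constructor
    · rw [Int.le_floor]; push_cast; nlinarith
    · have : (⌊L * ⟪b p.2, R g (b p.1)⟫_ℝ⌋ : ℝ) ≤ L := (Int.floor_le _).trans (by nlinarith)
      exact_mod_cast this
  have hker : ∀ g h, cell g = cell h → g⁻¹ * h ∈ R.ker := by
    intro g h hgh
    have hentry : ∀ i j, |⟪b j, R h (b i) - R g (b i)⟫_ℝ| * L ≤ 1 := by
      intro i j
      have h1 := Int.abs_sub_lt_one_of_floor_eq_floor (congrFun hgh (i, j))
      have h2 : ⟪b j, R h (b i) - R g (b i)⟫_ℝ * L =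
          -(L * ⟪b j, R g (b i)⟫_ℝ - L * ⟪b j, R h (b i)⟫_ℝ) := by
        rw [inner_sub_right]; ring
      rw [← abs_of_nonneg (Nat.cast_nonneg (α := ℝ) L), ← abs_mul, h2, abs_neg]
      exact h1.le
    have hvec : ∀ i, ‖R h (b i) - R g (b i)‖ * L ≤ d := by
      intro i
      have h1 : ‖R h (b i) - R g (b i)‖ ≤ ∑ j, |⟪b j, R h (b i) - R g (b i)⟫_ℝ| := by
        conv_lhs => rw [← b.sum_repr' (R h (b i) - R g (b i))]
        refine (norm_sum_le _ _).trans_eq (Finset.sum_congr rfl fun j _ => ?_)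
        rw [norm_smul, b.norm_eq_one, mul_one, Real.norm_eq_abs]
      calc _ ≤ (∑ j, |⟪b j, R h (b i) - R g (b i)⟫_ℝ|) * L := by gcongr
        _ ≤ ∑ _j : Fin d, 1 := by
          rw [Finset.sum_mul]; exact Finset.sum_le_sum fun j _ => hentry i j
        _ = d := by simp
    refine eq_one_of_pow_eq_one_of_norm_sub_le hm ?_ (hR _) ?_
    · rw [← map_pow, hG, map_one]
    intro v
    have h1 : ‖R (g⁻¹ * h) v - v‖ = ‖R h v - R g v‖ := by
      rw [← hR g, map_sub, ← Module.End.mul_apply, ← map_mul]; simp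
    have h2 : ‖R h v - R g v‖ * L ≤ ‖v‖ * D ^ 2 := by
      have h3 : R h v - R g v = ∑ i, ⟪b i, v⟫_ℝ • (R h (b i) - R g (b i)) := by
        conv_lhs => rw [← b.sum_repr' v]
        simp [map_sum, smul_sub, Finset.sum_sub_distrib]
      have h4 : ‖R h v - R g v‖ ≤ ∑ i, ‖v‖ * ‖R h (b i) - R g (b i)‖ := by
        rw [h3]
        refine (norm_sum_le _ _).trans (Finset.sum_le_sum fun i _ => ?_)
        rw [norm_smul, Real.norm_eq_abs]
        gcongr
        simpa using abs_real_inner_le_norm (b i) v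
      calc ‖R h v - R g v‖ * L ≤ (∑ i, ‖v‖ * ‖R h (b i) - R g (b i)‖) * L := by gcongr
        _ = ∑ i, ‖v‖ * (‖R h (b i) - R g (b i)‖ * L) := by
          rw [Finset.sum_mul]; simp_rw [mul_assoc]
        _ ≤ ∑ _i : Fin d, ‖v‖ * d := by gcongr with i; exact hvec i
        _ = ‖v‖ * d ^ 2 := by simp; ring
        _ ≤ _ := by gcongr
    rw [h1]
    rcases Nat.eq_zero_or_pos D with h0 | h0
    · have h5 : R h v - R g v = 0 := by simpa [h0, hL] using h2
      simp [h5]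
    · have hD' : (0 : ℝ) < (D : ℝ) ^ 2 := by positivity
      have h6 : (2 * m * (D : ℝ) ^ 2) ≤ L := by rw [hL]; push_cast; linarith
      have h7 : (2 * m * ‖R h v - R g v‖) * (D : ℝ) ^ 2 ≤ ‖v‖ * D ^ 2 :=
        calc _ = ‖R h v - R g v‖ * (2 * m * (D : ℝ) ^ 2) := by ring
          _ ≤ ‖R h v - R g v‖ * L := by gcongr
          _ ≤ _ := h2
      exact le_of_mul_le_mul_right h7 hD'
  let q : G ⧸ R.ker → (Fin d × Fin d → Finset.Icc (-(L : ℤ)) L) :=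
    fun x p => ⟨cell x.out p, hcell _ p⟩
  have hq : Function.Injective q := by
    intro x y hxy
    rw [← QuotientGroup.out_eq' x, ← QuotientGroup.out_eq' y, QuotientGroup.eq]
    exact hker _ _ (funext fun p => congrArg Subtype.val (congrFun hxy p))
  calc R.ker.index = Nat.card (G ⧸ R.ker) := rfl
    _ ≤ Nat.card (Fin d × Fin d → Finset.Icc (-(L : ℤ)) L) := Nat.card_le_card_of_injective q hq
    _ = (2 * L + 1) ^ d ^ 2 := by
      simp only [Nat.card_eq_fintype_card, Fintype.card_fun, Fintype.card_coe, Int.card_Icc,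
        Fintype.card_prod, Fintype.card_fin]
      congr 1
      · lia
      · ring
    _ ≤ _ := by gcongr; lia

/-- Simultaneous diagonalisation of the quadratic forms `‖T v‖ ^ 2` and `‖v‖ ^ 2`. -/
theorem exists_orthonormalBasis_inner_eq {E : Type*} [NormedAddCommGroup E]
    [InnerProductSpace ℝ E] [FiniteDimensional ℝ E] (T : E →ₗ[ℝ] E) :
    ∃ (b : OrthonormalBasis (Fin (Module.finrank ℝ E)) ℝ E) (μ : Fin (Module.finrank ℝ E) → ℝ),
      ∀ i v, ⟪T (b i), T v⟫_ℝ = μ i * ⟪b i, v⟫_ℝ := by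
  have hT := LinearMap.isSymmetric_adjoint_mul_self T
  refine ⟨hT.eigenvectorBasis rfl, hT.eigenvalues rfl, fun i v => ?_⟩
  rw [← LinearMap.adjoint_inner_left, ← Module.End.mul_apply, hT.apply_eigenvectorBasis,
    real_inner_smul_left]
  rfl

theorem sum_norm_sq_apply_eq {E ι κ : Type*} [Fintype ι] [Fintype κ] [NormedAddCommGroup E]
    [InnerProductSpace ℝ E] [FiniteDimensional ℝ E] (T : E →ₗ[ℝ] E) (b : OrthonormalBasis ι ℝ E)
    (e : OrthonormalBasis κ ℝ E) : ∑ i, ‖T (b i)‖ ^ 2 = ∑ i, ‖T (e i)‖ ^ 2 := by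
  have h : ∀ v, ‖T v‖ ^ 2 = ⟪v, (LinearMap.adjoint T * T) v⟫_ℝ := fun v => by
    rw [Module.End.mul_apply, LinearMap.adjoint_inner_right, real_inner_self_eq_norm_sq]
  simp_rw [h]
  rw [← LinearMap.trace_eq_sum_inner _ b, ← LinearMap.trace_eq_sum_inner _ e]

/-- An operator of bounded Hilbert–Schmidt norm commuting with an isometric action of a group of
exponent `m` is small away from the invariants of a normal subgroup of bounded index. -/
theorem exists_normal_subgroup_norm_sq_le {G E κ : Type*} [Group G] [Fintype κ]
    [NormedAddCommGroup E] [InnerProductSpace ℝ E] [FiniteDimensional ℝ E] {m D : ℕ} (hm : 1 ≤ m)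
    (hG : ∀ x : G, x ^ m = 1) (R : G →* (E →ₗ[ℝ] E)) (hR : ∀ g v w, ⟪R g v, R g w⟫_ℝ = ⟪v, w⟫_ℝ)
    (T : E →ₗ[ℝ] E) (hTR : ∀ g v, T (R g v) = R g (T v)) (e : OrthonormalBasis κ ℝ E) {θ : ℝ}
    (hθ : 0 < θ) (hT : ∑ i, ‖T (e i)‖ ^ 2 ≤ D * θ) :
    ∃ H : Subgroup G, H.Normal ∧ H.index ≤ (2 * (2 * m * D ^ 2 + 1) + 1) ^ D ^ 2 ∧
      ∀ v, (∀ w, (∀ h ∈ H, R h w = w) → ⟪w, v⟫_ℝ = 0) → ‖T v‖ ^ 2 ≤ θ * ‖v‖ ^ 2 := by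
  classical
  obtain ⟨b, μ, hb⟩ := exists_orthonormalBasis_inner_eq T
  have hμ : ∀ i, ‖T (b i)‖ ^ 2 = μ i := fun i => by
    rw [← real_inner_self_eq_norm_sq, hb, real_inner_self_eq_norm_sq, b.norm_eq_one]; ring
  let V : Submodule ℝ E := Submodule.span ℝ (Set.range fun i : {i // θ ≤ μ i} => b i)
  have hbV : ∀ i, θ ≤ μ i → b i ∈ V := fun i hi => Submodule.subset_span ⟨⟨i, hi⟩, rfl⟩
  have hdim : Module.finrank ℝ V ≤ D := by
    refine (finrank_range_le_card _).trans ?_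
    have h1 : (Fintype.card {i // θ ≤ μ i} : ℝ) * θ ≤ D * θ := by
      calc _ = ∑ i with θ ≤ μ i, θ := by rw [Fintype.card_subtype]; simp
        _ ≤ ∑ i with θ ≤ μ i, μ i := Finset.sum_le_sum fun i hi => (Finset.mem_filter.1 hi).2
        _ ≤ ∑ i, μ i := Finset.sum_le_sum_of_subset_of_nonneg (Finset.filter_subset _ _)
            fun i _ _ => by rw [← hμ]; positivity
        _ = ∑ i, ‖T (e i)‖ ^ 2 := by
            rw [← sum_norm_sq_apply_eq T b e]; exact Finset.sum_congr rfl fun i _ => (hμ i).symm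
        _ ≤ _ := hT
    exact_mod_cast le_of_mul_le_mul_right h1 hθ
  have hinv : ∀ g w u, ⟪w, R g u⟫_ℝ = ⟪R g⁻¹ w, u⟫_ℝ := fun g w u => by
    rw [← hR g (R g⁻¹ w), ← Module.End.mul_apply, ← map_mul]; simp
  have hRb : ∀ g i j, μ i ≠ μ j → ⟪b j, R g (b i)⟫_ℝ = 0 := by
    intro g i j hij
    have h1 : μ j * ⟪b j, R g (b i)⟫_ℝ = μ i * ⟪b j, R g (b i)⟫_ℝ := by
      rw [← hb, hTR, hinv, ← hTR, real_inner_comm, hb, real_inner_comm, ← hinv]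
    by_contra h
    exact hij (mul_right_cancel₀ h h1).symm
  have hV : ∀ g, ∀ v ∈ V, R g v ∈ V := by
    intro g v hv
    induction hv using Submodule.span_induction with
    | mem v hv =>
      obtain ⟨⟨i, hi⟩, rfl⟩ := hv
      rw [← b.sum_repr' (R g (b i))]
      refine Submodule.sum_mem _ fun j _ => ?_
      by_cases hij : μ i = μ j
      · exact Submodule.smul_mem _ _ (hbV j (hij ▸ hi))
      · rw [hRb g i j hij, zero_smul]; exact Submodule.zero_mem _
    | zero => simp
    | add v w _ _ hv hw => rw [map_add]; exact Submodule.add_mem _ hv hw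
    | smul a v _ hv => rw [map_smul]; exact Submodule.smul_mem _ _ hv
  let S : G →* (V →ₗ[ℝ] V) :=
    { toFun := fun g => (R g).restrict (hV g)
      map_one' := by ext v; simp
      map_mul' := fun g h => by ext v; simp }
  have hS : ∀ g v, ‖S g v‖ = ‖v‖ := fun g v => by
    have := hR g v v
    rw [real_inner_self_eq_norm_sq, real_inner_self_eq_norm_sq] at this
    exact (sq_eq_sq₀ (norm_nonneg _) (norm_nonneg _)).1 this
  refine ⟨S.ker, inferInstance, index_ker_le hm hG S hS hdim, fun v hv => ?_⟩
  have hbv : ∀ i, θ ≤ μ i → ⟪b i, v⟫_ℝ = 0 := fun i hi => hv _ fun h hh =>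
    congrArg Subtype.val (LinearMap.congr_fun (MonoidHom.mem_ker.1 hh) (⟨b i, hbV i hi⟩ : V))
  have hTv : ‖T v‖ ^ 2 = ∑ i, μ i * ⟪b i, v⟫_ℝ ^ 2 := by
    have h1 : T v = ∑ i, ⟪b i, v⟫_ℝ • T (b i) := by
      conv_lhs => rw [← b.sum_repr' v]
      simp [map_sum]
    calc ‖T v‖ ^ 2 = ⟪∑ i, ⟪b i, v⟫_ℝ • T (b i), T v⟫_ℝ := by
          rw [← h1, real_inner_self_eq_norm_sq]
      _ = _ := by
          rw [sum_inner]
          refine Finset.sum_congr rfl fun i _ => ?_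
          rw [real_inner_smul_left, hb]; ring
  rw [hTv, ← b.sum_sq_norm_inner_right v, Finset.mul_sum]
  refine Finset.sum_le_sum fun i _ => ?_
  rw [Real.norm_eq_abs, sq_abs]
  by_cases hi : θ ≤ μ i
  · rw [hbv i hi]; simp
  · have := not_le.1 hi
    gcongr

section CosetAverage

variable {G : Type*} [Group G] (H : Subgroup G) [Fintype H]

/-- The average of `f` over the left coset `x * H`. -/
noncomputable def cosetAverage (f : G → ℝ) (x : G) : ℝ := (∑ h : H, f (x * h)) / Fintype.card H

theorem cosetAverage_mul_right (f : G → ℝ) (x : G) {k : G} (hk : k ∈ H) :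
    cosetAverage H f (x * k) = cosetAverage H f x := by
  unfold cosetAverage
  congr 1
  refine Fintype.sum_equiv (Equiv.mulLeft (⟨k, hk⟩ : H)) _ _ fun h => ?_
  simp [mul_assoc]

theorem cosetAverage_mul_left [H.Normal] (f : G → ℝ) (x : G) {k : G} (hk : k ∈ H) :
    cosetAverage H f (k * x) = cosetAverage H f x := by
  have h := cosetAverage_mul_right H f x (Subgroup.Normal.conj_mem' ‹_› k hk x)
  rwa [← mul_assoc, ← mul_assoc, mul_inv_cancel, one_mul] at h

variable [Fintype G]

theorem sum_cosetAverage_mul {f w : G → ℝ} (hw : ∀ x, ∀ h ∈ H, w (x * h) = w x) :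
    ∑ x, cosetAverage H f x * w x = ∑ x, f x * w x := by
  have h1 : ∀ h : H, ∑ x, f (x * h) * w x = ∑ x, f x * w x := fun h =>
    Fintype.sum_equiv (Equiv.mulRight (h : G)) _ _ fun x => by simp [hw x h h.2]
  have h2 : (Fintype.card H : ℝ) ≠ 0 := by simp
  simp_rw [cosetAverage, div_mul_eq_mul_div, ← Finset.sum_div, Finset.sum_mul]
  rw [Finset.sum_comm, div_eq_iff h2]
  simp only [h1, Finset.sum_const, Finset.card_univ, nsmul_eq_mul]
  ring

theorem sum_cosetAverage (f : G → ℝ) : ∑ x, cosetAverage H f x = ∑ x, f x := by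
  simpa using sum_cosetAverage_mul H (f := f) (w := 1) (by simp)

theorem sum_mul_cosetAverage (f : G → ℝ) :
    ∑ x, f x * cosetAverage H f x = ∑ x, cosetAverage H f x ^ 2 := by
  simp_rw [sq]
  exact (sum_cosetAverage_mul H fun x h hh => cosetAverage_mul_right H f x hh).symm

theorem sq_sum_le_card_mul_sum_cosetAverage (f : G → ℝ) :
    (∑ x, f x) ^ 2 ≤ Fintype.card G * ∑ x, f x * cosetAverage H f x := by
  rw [sum_mul_cosetAverage, ← sum_cosetAverage H f]
  exact sq_sum_le_card_mul_sum_sq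

end CosetAverage

theorem indicator_one_nonneg {α : Type*} (A : Set α) (x : α) : 0 ≤ A.indicator (1 : α → ℝ) x :=
  Set.indicator_nonneg (by simp) x

theorem indicator_one_le_one {α : Type*} (A : Set α) (x : α) : A.indicator (1 : α → ℝ) x ≤ 1 :=
  Set.indicator_le_self' (fun _ _ => zero_le_one) x

theorem sum_indicator_one {α : Type*} [Fintype α] (A : Set α) :
    ∑ x, A.indicator (1 : α → ℝ) x = A.ncard := by
  classical
  simp [Set.ncard_eq_toFinset_card', Set.indicator_apply]

section Popularity

variable {G : Type*} [Group G] [Fintype G] (A : Set G)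

/-- The number of ways to write `y` as `u * v⁻¹` with `u, v ∈ A`. -/
noncomputable def quotientCount (y : G) : ℝ :=
  ∑ v, A.indicator 1 (y * v) * A.indicator 1 v

theorem quotientCount_le (y : G) : quotientCount A y ≤ Fintype.card G := by
  calc quotientCount A y ≤ ∑ _v : G, (1 : ℝ) := Finset.sum_le_sum fun v _ =>
        mul_le_one₀ (indicator_one_le_one A _) (indicator_one_nonneg A _) (indicator_one_le_one A _)
    _ = _ := by simp

variable {A} in
theorem quotientCount_eq_zero {y : G} (hy : y ∉ A * A⁻¹) : quotientCount A y = 0 := by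
  refine Finset.sum_eq_zero fun v _ => ?_
  by_contra h
  obtain ⟨h1, h2⟩ := mul_ne_zero_iff.1 h
  exact hy ⟨y * v, Set.mem_of_indicator_ne_zero h1, v⁻¹,
    by simpa using Set.mem_of_indicator_ne_zero h2, by simp⟩

theorem sum_quotientCount_mul (w : G → ℝ) :
    ∑ y, quotientCount A y * w y =
      ∑ x, A.indicator 1 x * ∑ v, A.indicator 1 v * w (x * v⁻¹) := by
  simp_rw [quotientCount, Finset.sum_mul, Finset.mul_sum]
  rw [Finset.sum_comm, Finset.sum_comm (f := fun x v =>
    A.indicator 1 x * (A.indicator 1 v * w (x * v⁻¹)))]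
  refine Finset.sum_congr rfl fun v _ => ?_
  refine Fintype.sum_equiv (Equiv.mulRight v) _ _ fun y => ?_
  simp
  ring

theorem sum_quotientCount : ∑ y, quotientCount A y = (A.ncard : ℝ) ^ 2 := by
  have h := sum_quotientCount_mul A 1
  simp only [Pi.one_apply, mul_one, sum_indicator_one] at h
  rw [h, ← Finset.sum_mul, sum_indicator_one, sq]

variable (H : Subgroup G) [Fintype H]

theorem cosetAverage_quotientCount_le (x : G) :
    cosetAverage H (quotientCount A) x ≤ Fintype.card G := by
  rw [cosetAverage, div_le_iff₀ (by exact_mod_cast Fintype.card_pos)]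
  calc _ ≤ ∑ _h : H, (Fintype.card G : ℝ) := Finset.sum_le_sum fun h _ => quotientCount_le A _
    _ = _ := by simp [mul_comm]

theorem ncard_sq_le_card_mul_cosetAverage [H.Normal] {x : G} (hx : x ∈ H) :
    (A.ncard : ℝ) ^ 2 ≤ Fintype.card G * cosetAverage H (quotientCount A) x := by
  have h1 : cosetAverage H (quotientCount A) x =
      ∑ v, A.indicator 1 v * cosetAverage H (A.indicator 1) v := by
    rw [← one_mul x, cosetAverage_mul_right H _ _ hx]
    simp_rw [cosetAverage, quotientCount, mul_div_assoc', ← Finset.sum_div, Finset.mul_sum]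
    rw [Finset.sum_comm]
    congr 1
    refine Finset.sum_congr rfl fun v _ => ?_
    refine Fintype.sum_equiv (MulAut.conjNormal v⁻¹ : H ≃* H).toEquiv _ _ fun h => ?_
    simp [mul_comm, mul_assoc]
  rw [h1, ← sum_indicator_one]
  exact sq_sum_le_card_mul_sum_cosetAverage H _

theorem ncard_pow_four_le_card_mul_sum :
    (A.ncard : ℝ) ^ 4 ≤
      Fintype.card G * ∑ x, cosetAverage H (quotientCount A) x ^ 2 := by
  have := sq_sum_le_card_mul_sum_cosetAverage H (quotientCount A)
  rw [sum_quotientCount, sum_mul_cosetAverage] at this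
  linarith

variable {A H} {c κ : ℝ}

theorem ncard_diff_le [H.Normal] (hc : 0 < c) (hA : c * Fintype.card G ≤ A.ncard)
    (hκ : ∑ x, (quotientCount A x - cosetAverage H (quotientCount A) x) ^ 2 ≤
      κ * Fintype.card G ^ 3) :
    c ^ 4 * (((H : Set G) \ (A * A⁻¹)).ncard : ℝ) ≤ κ * Fintype.card G := by
  set n : ℝ := (Fintype.card G : ℝ) with hn
  have hn0 : 0 < n := by rw [hn]; exact_mod_cast Fintype.card_pos
  set S := (H : Set G) \ (A * A⁻¹)
  have h1 : ∀ x, S.indicator 1 x * (c ^ 4 * n ^ 2) ≤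
      (quotientCount A x - cosetAverage H (quotientCount A) x) ^ 2 := by
    intro x
    by_cases hx : x ∈ S
    · rw [Set.indicator_of_mem hx, quotientCount_eq_zero hx.2]
      have h2 := ncard_sq_le_card_mul_cosetAverage A H hx.1
      have h3 : c ^ 2 * n ≤ cosetAverage H (quotientCount A) x := by
        refine le_of_mul_le_mul_left ?_ hn0
        calc n * (c ^ 2 * n) = (c * n) ^ 2 := by ring
          _ ≤ (A.ncard : ℝ) ^ 2 := by gcongr
          _ ≤ _ := h2
      calc _ = (c ^ 2 * n) ^ 2 := by simp; ring
        _ ≤ cosetAverage H (quotientCount A) x ^ 2 := by gcongr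
        _ = _ := by ring
    · rw [Set.indicator_of_notMem hx, zero_mul]; positivity
  have h2 := (Finset.sum_le_sum fun x (_ : x ∈ Finset.univ) => h1 x).trans hκ
  rw [← Finset.sum_mul, sum_indicator_one] at h2
  refine le_of_mul_le_mul_right ?_ (pow_pos hn0 2)
  linarith

theorem subset_mul_of_lt (hc : 0 < c) (hA : c * Fintype.card G ≤ A.ncard)
    (hκ : ∑ x, (quotientCount A x - cosetAverage H (quotientCount A) x) ^ 2 ≤
      κ * Fintype.card G ^ 3) (hκc : 2 * κ < c ^ 4) :
    (H : Set G) ⊆ (A * A⁻¹) * (A * A⁻¹) := by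
  intro x hx
  by_contra hxA
  set n : ℝ := (Fintype.card G : ℝ) with hn
  have hn0 : 0 < n := by rw [hn]; exact_mod_cast Fintype.card_pos
  set F := quotientCount A
  set Q := cosetAverage H F
  have h1 : ∀ y, Q y ^ 2 ≤ (F y - Q y) ^ 2 + (F (y * x) - Q (y * x)) ^ 2 := by
    intro y
    by_cases hy : y ∈ A * A⁻¹
    · have hyx : y * x ∉ A * A⁻¹ := fun h =>
        hxA ⟨y⁻¹, by simpa [mul_inv_rev] using Set.inv_mem_inv.2 hy, y * x, h, by simp⟩
      rw [show F (y * x) = 0 from quotientCount_eq_zero hyx,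
        show Q (y * x) = Q y from cosetAverage_mul_right H F y hx]
      nlinarith [sq_nonneg (F y - Q y)]
    · rw [show F y = 0 from quotientCount_eq_zero hy]
      nlinarith [sq_nonneg (F (y * x) - Q (y * x))]
  have h2 := Finset.sum_le_sum fun y (_ : y ∈ Finset.univ) => h1 y
  rw [Finset.sum_add_distrib, Fintype.sum_equiv (Equiv.mulRight x)
    (fun y => (F (y * x) - Q (y * x)) ^ 2) (fun y => (F y - Q y) ^ 2) (by simp)] at h2
  have h3 : (c * n) ^ 4 ≤ n * ∑ x, Q x ^ 2 :=
    (by gcongr : (c * n) ^ 4 ≤ (A.ncard : ℝ) ^ 4).trans (ncard_pow_four_le_card_mul_sum A H)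
  have h4 : n * ∑ x, Q x ^ 2 ≤ n * (2 * κ * n ^ 3) := by gcongr; linarith
  have h5 : c ^ 4 * n ^ 4 ≤ 2 * κ * n ^ 4 := by linarith
  exact absurd (le_of_mul_le_mul_right h5 (pow_pos hn0 4)) (not_le.2 hκc)

theorem exists_coset_subset [H.Normal] {τ : ℝ} (hτ : 0 ≤ τ) {N : ℕ} (hN : H.index ≤ N)
    {δ : ℝ} (hδ : 0 ≤ δ) (hc : 0 < c) (hA : c * Fintype.card G ≤ A.ncard)
    (hκ : ∑ x, (quotientCount A x - cosetAverage H (quotientCount A) x) ^ 2 ≤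
      τ ^ 2 * Fintype.card G ^ 3) (hlt : τ + N * δ < c ^ 4) :
    ∃ g : G, (H : Set G) * {g} ⊆ A * A⁻¹ * A ∧
      δ * (Fintype.card G : ℝ) ≤ ((((H : Set G) * {g}) ∩ A).ncard : ℝ) := by
  classical
  by_contra! hbad
  set n : ℝ := (Fintype.card G : ℝ) with hn
  have hn0 : 0 < n := by rw [hn]; exact_mod_cast Fintype.card_pos
  have hAn : (A.ncard : ℝ) ≤ n := by
    rw [hn, ← Nat.card_eq_fintype_card]; exact_mod_cast Set.ncard_le_card A
  set F := quotientCount A with hF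
  set Q := cosetAverage H F with hQ
  set W : G → ℝ := fun x => ∑ v, A.indicator 1 v * Q (x * v⁻¹) with hW
  have hWn : ∀ x, W x ≤ n ^ 2 := fun x => by
    calc W x ≤ ∑ v, A.indicator 1 v * n := Finset.sum_le_sum fun v _ =>
          mul_le_mul_of_nonneg_left (cosetAverage_quotientCount_le A H _)
            (indicator_one_nonneg A _)
      _ = A.ncard * n := by rw [← Finset.sum_mul, sum_indicator_one]
      _ ≤ n ^ 2 := by rw [sq]; gcongr
  have hWsmall : ∀ x, ¬ (H : Set G) * {x} ⊆ A * A⁻¹ * A → W x ≤ τ * n ^ 2 := by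
    intro x hx
    obtain ⟨_, ⟨h, hh, x', hx', rfl⟩, hxA⟩ := Set.not_subset.1 hx
    obtain rfl := Set.mem_singleton_iff.1 hx'
    have h1 : W x' = ∑ v, A.indicator 1 v * (Q (h * x' * v⁻¹) - F (h * x' * v⁻¹)) := by
      refine Finset.sum_congr rfl fun v _ => ?_
      by_cases hv : v ∈ A
      · have h2 : h * x' * v⁻¹ ∉ A * A⁻¹ := fun h3 => hxA ⟨_, h3, v, hv, by simp⟩
        rw [show F (h * x' * v⁻¹) = 0 from quotientCount_eq_zero h2, mul_assoc h,
          show Q (h * (x' * v⁻¹)) = Q (x' * v⁻¹) from cosetAverage_mul_left H F _ hh, sub_zero]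
      · simp [hv]
    have h2 : W x' ^ 2 ≤ (τ * n ^ 2) ^ 2 := by
      rw [h1]
      refine (Finset.sum_mul_sq_le_sq_mul_sq _ _ _).trans ?_
      have h3 : ∑ v, A.indicator (1 : G → ℝ) v ^ 2 ≤ n := by
        calc _ ≤ ∑ _v : G, (1 : ℝ) := Finset.sum_le_sum fun v _ =>
              pow_le_one₀ (indicator_one_nonneg A v) (indicator_one_le_one A v)
          _ = n := by simp [hn]
      have h4 : ∑ v, (Q (h * x' * v⁻¹) - F (h * x' * v⁻¹)) ^ 2 ≤ τ ^ 2 * n ^ 3 := by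
        refine le_trans (le_of_eq ?_) hκ
        refine Fintype.sum_equiv ((Equiv.inv G).trans (Equiv.mulLeft (h * x'))) _ _ fun v => ?_
        simp only [Equiv.trans_apply, Equiv.inv_apply, Equiv.coe_mulLeft]
        ring
      calc _ ≤ n * (τ ^ 2 * n ^ 3) := by gcongr
        _ = _ := by ring
    exact abs_le_of_sq_le_sq' h2 (by positivity) |>.2
  have hfew : ((Finset.univ.filter fun x => x ∈ A ∧ (H : Set G) * {x} ⊆ A * A⁻¹ * A).card : ℝ) ≤
      N * (δ * n) := by
    rw [Finset.card_eq_sum_card_fiberwise (f := fun x : G => (x : G ⧸ H)) (t := Finset.univ)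
      (by simp)]
    push_cast
    have hcard : (Fintype.card (G ⧸ H) : ℝ) ≤ N := by
      rw [← Nat.card_eq_fintype_card]; exact_mod_cast hN
    calc _ ≤ ∑ _q : G ⧸ H, δ * n := Finset.sum_le_sum fun q _ => ?_
      _ ≤ _ := by simp only [Finset.sum_const, nsmul_eq_mul, Finset.card_univ]; gcongr
    rcases Finset.eq_empty_or_nonempty ((Finset.univ.filter fun x => x ∈ A ∧
        (H : Set G) * {x} ⊆ A * A⁻¹ * A).filter fun x : G => (x : G ⧸ H) = q) with h0 | ⟨x, hx⟩
    · rw [h0]; simp; positivity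
    · simp only [Finset.mem_filter, Finset.mem_univ, true_and] at hx
      refine le_trans ?_ (hbad x hx.1.2).le
      rw [← Set.ncard_coe_finset]
      refine Nat.cast_le.2 (Set.ncard_le_ncard (fun y hy => ?_) (Set.toFinite _))
      simp only [Finset.coe_filter, Finset.mem_filter, Finset.mem_univ, true_and,
        Set.mem_ofPred_eq] at hy
      refine ⟨⟨y * x⁻¹, ?_, x, rfl, by simp⟩, hy.1.1⟩
      have h1 : x⁻¹ * y ∈ H := QuotientGroup.eq.1 (hx.2.trans hy.2.symm)
      simpa using Subgroup.Normal.conj_mem ‹_› _ h1 x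
  have hsum : ∑ x, A.indicator 1 x * W x ≤ n * (τ * n ^ 2) + N * (δ * n) * n ^ 2 := by
    calc ∑ x, A.indicator 1 x * W x ≤ ∑ x, (τ * n ^ 2 +
          if x ∈ A ∧ (H : Set G) * {x} ⊆ A * A⁻¹ * A then n ^ 2 else 0) := by
          refine Finset.sum_le_sum fun x _ => ?_
          have h0 : 0 ≤ τ * n ^ 2 := by positivity
          by_cases hxA : x ∈ A
          · by_cases hxH : (H : Set G) * {x} ⊆ A * A⁻¹ * A
            · simp only [hxA, hxH, Set.indicator_of_mem, Pi.one_apply, one_mul, and_self, if_true]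
              linarith [hWn x]
            · simp only [hxA, hxH, Set.indicator_of_mem, Pi.one_apply, one_mul, and_false, if_false]
              linarith [hWsmall x hxH]
          · simpa [hxA] using h0
      _ = n * (τ * n ^ 2) +
          (Finset.univ.filter fun x => x ∈ A ∧ (H : Set G) * {x} ⊆ A * A⁻¹ * A).card * n ^ 2 := by
          rw [Finset.sum_add_distrib, ← Finset.sum_filter]; simp [hn]
      _ ≤ _ := by gcongr
  have hW2 : ∑ x, A.indicator 1 x * W x = ∑ x, Q x ^ 2 := by
    rw [hQ, ← sum_mul_cosetAverage, hF, sum_quotientCount_mul]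
  have h3 : (c * n) ^ 4 ≤ n * ∑ x, Q x ^ 2 :=
    (by gcongr : (c * n) ^ 4 ≤ (A.ncard : ℝ) ^ 4).trans (ncard_pow_four_le_card_mul_sum A H)
  rw [hW2] at hsum
  have h4 : n * ∑ x, Q x ^ 2 ≤ n * (n * (τ * n ^ 2) + N * (δ * n) * n ^ 2) := by gcongr
  have h5 : c ^ 4 * n ^ 4 ≤ (τ + N * δ) * n ^ 4 := by linarith
  exact absurd (le_of_mul_le_mul_right h5 (pow_pos hn0 4)) (not_le.2 hlt)

end Popularity

section Regularity

variable {G : Type*} [Group G] [Fintype G]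

/-- The right regular representation on real-valued functions. -/
noncomputable def rightTranslation (G : Type*) [Group G] [Fintype G] :
    G →* (EuclideanSpace ℝ G →ₗ[ℝ] EuclideanSpace ℝ G) where
  toFun h :=
    { toFun := fun v => WithLp.toLp 2 fun x => v (x * h)
      map_add' := fun v w => by ext; simp
      map_smul' := fun r v => by ext; simp }
  map_one' := by ext; simp
  map_mul' g h := by ext; simp [mul_assoc]

@[simp]
theorem rightTranslation_apply (h : G) (v : EuclideanSpace ℝ G) (x : G) :
    rightTranslation G h v x = v (x * h) := rfl

theorem inner_rightTranslation (h : G) (v w : EuclideanSpace ℝ G) :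
    inner ℝ (rightTranslation G h v) (rightTranslation G h w) = inner ℝ v w := by
  simp only [PiLp.inner_apply, rightTranslation_apply]
  exact Fintype.sum_equiv (Equiv.mulRight h) _ _ fun x => rfl

/-- Left convolution by `a`. -/
noncomputable def leftConvolution (a : G → ℝ) : EuclideanSpace ℝ G →ₗ[ℝ] EuclideanSpace ℝ G where
  toFun v := WithLp.toLp 2 fun x => ∑ y, a (x * y) * v y⁻¹
  map_add' v w := by ext; simp [mul_add, Finset.sum_add_distrib]
  map_smul' r v := by ext; simp [Finset.mul_sum, mul_left_comm]

@[simp]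
theorem leftConvolution_apply (a : G → ℝ) (v : EuclideanSpace ℝ G) (x : G) :
    leftConvolution a v x = ∑ y, a (x * y) * v y⁻¹ := rfl

theorem leftConvolution_rightTranslation (a : G → ℝ) (h : G) (v : EuclideanSpace ℝ G) :
    leftConvolution a (rightTranslation G h v) = rightTranslation G h (leftConvolution a v) := by
  ext x
  simp only [leftConvolution_apply, rightTranslation_apply]
  refine Fintype.sum_equiv (Equiv.mulLeft h⁻¹) _ _ fun y => ?_
  simp [mul_assoc]

theorem sum_norm_leftConvolution_indicator_le [DecidableEq G] (A : Set G) :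
    ∑ y, ‖leftConvolution (A.indicator 1) (EuclideanSpace.basisFun G ℝ y)‖ ^ 2 ≤
      (Fintype.card G : ℝ) ^ 2 := by
  have h : ∀ y x, leftConvolution (A.indicator 1) (EuclideanSpace.basisFun G ℝ y) x =
      A.indicator 1 (x * y⁻¹) := by
    intro y x
    simp [inv_eq_iff_eq_inv]
  simp_rw [EuclideanSpace.norm_sq_eq, h]
  calc _ ≤ ∑ _y : G, ∑ _x : G, (1 : ℝ) := by
        refine Finset.sum_le_sum fun y _ => Finset.sum_le_sum fun x _ => ?_
        rw [Real.norm_eq_abs, sq_abs]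
        exact pow_le_one₀ (indicator_one_nonneg A _) (indicator_one_le_one A _)
    _ = _ := by simp [sq]

/-- In a group of exponent `m`, the number of representations by `A * A⁻¹` is close in mean square
to its average over the cosets of a normal subgroup of bounded index. -/
theorem exists_normal_subgroup_sum_sq_le {m D : ℕ} (hm : 1 ≤ m) (hG : ∀ x : G, x ^ m = 1)
    {κ : ℝ} (hκ : 0 < κ) (hD : 4 ≤ D * κ) (A : Set G) :
    ∃ H : Subgroup G, H.Normal ∧ H.index ≤ (2 * (2 * m * D ^ 2 + 1) + 1) ^ D ^ 2 ∧
      ∀ [Fintype H], ∑ x, (quotientCount A x - cosetAverage H (quotientCount A) x) ^ 2 ≤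
        κ * Fintype.card G ^ 3 := by
  classical
  set n : ℝ := (Fintype.card G : ℝ) with hn
  have hn0 : 0 < n := by rw [hn]; exact_mod_cast Fintype.card_pos
  set T := leftConvolution (A.indicator (1 : G → ℝ)) with hT
  set R := rightTranslation G with hR
  obtain ⟨H, hH, hindex, hsmall⟩ := exists_normal_subgroup_norm_sq_le (D := D) hm hG R
    inner_rightTranslation T (leftConvolution_rightTranslation _) (EuclideanSpace.basisFun G ℝ)
    (θ := κ * n ^ 2 / 4) (by positivity)
    ((sum_norm_leftConvolution_indicator_le A).trans (by nlinarith [sq_nonneg n]))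
  refine ⟨H, hH, hindex, ?_⟩
  intro _
  set a : EuclideanSpace ℝ G := WithLp.toLp 2 fun x => A.indicator 1 x⁻¹ with ha
  set P : EuclideanSpace ℝ G →ₗ[ℝ] EuclideanSpace ℝ G :=
    (Fintype.card H : ℝ)⁻¹ • ∑ h : H, R h with hP
  have hcard : (Fintype.card H : ℝ) ≠ 0 := by simp
  have hTP : T (a - P a) = T a - P (T a) := by
    rw [map_sub, hP]
    simp [map_sum, hT, hR, leftConvolution_rightTranslation]
  have horth : ∀ w, (∀ h ∈ H, R h w = w) → inner ℝ w (a - P a) = 0 := by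
    intro w hw
    have h1 : ∀ h : H, inner ℝ w (R h a) = inner ℝ w a := fun h => by
      conv_lhs => rw [← hw h h.2]
      exact inner_rightTranslation _ _ _
    rw [inner_sub_right, hP]
    simp [inner_smul_right, inner_sum, h1, hcard]
  have hnorm : ‖a - P a‖ ^ 2 ≤ 4 * n := by
    have h1 : ‖a‖ ^ 2 ≤ n := by
      rw [EuclideanSpace.norm_sq_eq]
      calc _ ≤ ∑ _x : G, (1 : ℝ) := by
            refine Finset.sum_le_sum fun x _ => ?_
            rw [Real.norm_eq_abs, sq_abs]
            exact pow_le_one₀ (indicator_one_nonneg A _) (indicator_one_le_one A _)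
        _ = n := by simp [hn]
    have h2 : ∀ h : G, ‖R h a‖ = ‖a‖ := fun h => by
      have := inner_rightTranslation h a a
      rw [real_inner_self_eq_norm_sq, real_inner_self_eq_norm_sq] at this
      exact (sq_eq_sq₀ (norm_nonneg _) (norm_nonneg _)).1 this
    have h3 : ‖P a‖ ≤ ‖a‖ := by
      have h4 : ‖∑ h : H, R h a‖ ≤ Fintype.card H * ‖a‖ := by
        refine (norm_sum_le _ _).trans ?_
        simp [h2]
      rw [hP, LinearMap.smul_apply, LinearMap.sum_apply, norm_smul, norm_inv, Real.norm_natCast,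
        inv_mul_le_iff₀ (by positivity)]
      exact h4
    have h4 : ‖a - P a‖ ≤ 2 * ‖a‖ := (norm_sub_le _ _).trans (by linarith)
    calc _ ≤ (2 * ‖a‖) ^ 2 := by gcongr
      _ ≤ _ := by linarith
  have hTa : ∀ x, T a x = quotientCount A x := fun x => by
    simp [hT, ha, quotientCount]
  have hPTa : ∀ x, P (T a) x = cosetAverage H (quotientCount A) x := fun x => by
    simp only [hP, cosetAverage, ← hTa]
    simp [hR, div_eq_inv_mul]
  have h := hsmall _ horth
  rw [hTP, EuclideanSpace.norm_sq_eq] at h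
  simp only [PiLp.sub_apply, hTa, hPTa, Real.norm_eq_abs, sq_abs] at h
  calc _ ≤ κ * n ^ 2 / 4 * ‖a - P a‖ ^ 2 := h
    _ ≤ κ * n ^ 2 / 4 * (4 * n) := by gcongr
    _ = _ := by ring

end Regularity

theorem stmt_3 (c ε : ℝ) (hc : 0 < c) (hε : 0 < ε) (m : ℕ) (hm : 1 ≤ m) :
    ∃ (k : ℕ) (δ : ℝ), 0 < k ∧ 0 < δ ∧
      ∀ (G : Type) [Group G] [Fintype G] (A : Set G),
        (∀ x : G, x ^ m = 1) →
        ProductFree A → c * (Fintype.card G : ℝ) ≤ (A.ncard : ℝ) →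
        ∃ H : Subgroup G, H.Normal ∧ H ≠ ⊤ ∧ H.index ≤ k ∧
          (H : Set G) ⊆ (A * A⁻¹) * (A * A⁻¹) ∧
          (((H : Set G) \ (A * A⁻¹)).ncard : ℝ) < ε * (Fintype.card G : ℝ) ∧
          ∃ g : G, (H : Set G) * {g} ⊆ A * A⁻¹ * A ∧
            δ * (Fintype.card G : ℝ) ≤ ((((H : Set G) * {g}) ∩ A).ncard : ℝ) := by
  have hc4 : 0 < c ^ 4 := by positivity
  set η := min ε c with hη
  have hη0 : 0 < η := lt_min hε hc
  set τ := min (1 / 2) (min (c ^ 4 / 4) (η * c ^ 4 / 2)) with hτ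
  have hτ0 : 0 < τ := by positivity
  have hτ1 : τ ≤ 1 / 2 := min_le_left _ _
  have hτ2 : τ ≤ c ^ 4 / 4 := (min_le_right _ _).trans (min_le_left _ _)
  have hτ3 : τ ≤ η * c ^ 4 / 2 := (min_le_right _ _).trans (min_le_right _ _)
  have hττ : τ ^ 2 ≤ τ / 2 := by nlinarith
  obtain ⟨D, hD⟩ := exists_nat_ge (4 / τ ^ 2)
  rw [div_le_iff₀ (by positivity)] at hD
  set k : ℕ := (2 * (2 * m * D ^ 2 + 1) + 1) ^ D ^ 2 with hk
  have hk0 : 0 < k := by positivity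
  have hkδ : (k : ℝ) * (c ^ 4 / (4 * k)) = c ^ 4 / 4 := by
    have : (k : ℝ) ≠ 0 := by positivity
    field_simp
  refine ⟨k, c ^ 4 / (4 * k), hk0, by positivity, ?_⟩
  intro G _ _ A hG hfree hA
  classical
  obtain ⟨H, hH, hindex, hclose⟩ :=
    exists_normal_subgroup_sum_sq_le hm hG (sq_pos_of_pos hτ0) hD A
  have hn0 : (0 : ℝ) < Fintype.card G := by exact_mod_cast Fintype.card_pos
  have hdiff : (((H : Set G) \ (A * A⁻¹)).ncard : ℝ) < η * Fintype.card G := by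
    have h1 := ncard_diff_le hc hA hclose
    refine lt_of_mul_lt_mul_left (h1.trans_lt ?_) hc4.le
    calc τ ^ 2 * Fintype.card G < η * c ^ 4 * Fintype.card G := by gcongr; linarith
      _ = _ := by ring
  refine ⟨H, hH, ?_, hindex, subset_mul_of_lt hc hA hclose (by linarith),
    hdiff.trans_le (by gcongr; exact min_le_left _ _),
    exists_coset_subset hτ0.le hindex (by positivity) hc hA hclose (by linarith)⟩
  rintro rfl
  have h1 : A ⊆ ((⊤ : Subgroup G) : Set G) \ (A * A⁻¹) := by
    refine fun x hx => ⟨trivial, ?_⟩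
    rintro ⟨u, hu, v, hv, rfl⟩
    exact hfree _ hx _ hv (by simpa using hu)
  have h2 : (A.ncard : ℝ) ≤ (((⊤ : Subgroup G) : Set G) \ (A * A⁻¹)).ncard :=
    Nat.cast_le.2 (Set.ncard_le_ncard h1 (Set.toFinite _))
  have h3 : η * Fintype.card G ≤ c * Fintype.card G := by gcongr; exact min_le_right _ _
  linarith
end

section
/- For every real number c > 0 there exists a positive integer d = d(c) such that the following holds. If G is a d-quasirandom finite group of order n and A, B, C are subsets of G each of size at least c·n, then ABC = G. -/
open Pointwise

/-- A group `G` is `d`-quasirandom if every homomorphism from `G` into a complex unitary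
group `U_m(ℂ)` with `m < d` is trivial. -/
def IsQuasirandom (d : ℕ) (G : Type*) [Group G] : Prop :=
  ∀ m : ℕ, m < d → ∀ f : G →* Matrix.unitaryGroup (Fin m) ℂ, ∀ g : G, f g = 1

section Operators

variable {E : Type*} [NormedAddCommGroup E] [InnerProductSpace ℂ E] [FiniteDimensional ℂ E]

/-- If every eigenvalue of `T† T` is at most `M` then `‖T v‖² ≤ M ‖v‖²`. -/
theorem norm_sq_apply_le_of_eigenvalue_le (T : E →ₗ[ℂ] E) (M : ℝ)
    (h : ∀ (μ : ℝ) (v : E), v ≠ 0 → T.adjoint (T v) = (μ : ℂ) • v → μ ≤ M) (v : E) :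
    ‖T v‖ ^ 2 ≤ M * ‖v‖ ^ 2 := by
  have hS : (T.adjoint ∘ₗ T).IsSymmetric := (LinearMap.isPositive_adjoint_comp_self T).isSymmetric
  set e := hS.eigenvectorBasis rfl
  have hev (i) : T.adjoint (T (e i)) = ((hS.eigenvalues rfl i : ℝ) : ℂ) • e i :=
    hS.apply_eigenvectorBasis rfl i
  have hle (i) : hS.eigenvalues rfl i ≤ M := h _ (e i) (e.orthonormal.ne_zero i) (hev i)
  have hsum : ‖T v‖ ^ 2 = ∑ i, hS.eigenvalues rfl i * ‖inner ℂ (e i) v‖ ^ 2 := by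
    have h1 : inner ℂ (T v) (T v) = ∑ i, inner ℂ (T.adjoint (T v)) (e i) * inner ℂ (e i) v := by
      rw [e.sum_inner_mul_inner, LinearMap.adjoint_inner_left]
    have h2 (i) : inner ℂ (T.adjoint (T v)) (e i) * inner ℂ (e i) v
        = ((hS.eigenvalues rfl i * ‖inner ℂ (e i) v‖ ^ 2 : ℝ) : ℂ) := by
      rw [LinearMap.adjoint_inner_left, ← LinearMap.adjoint_inner_right, hev, inner_smul_right,
        mul_assoc, ← inner_conj_symm v (e i), Complex.conj_mul']
      push_cast
      rfl
    rw [inner_self_eq_norm_sq_to_K, Finset.sum_congr rfl fun i _ => h2 i] at h1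
    exact Complex.ofReal_injective (by simpa using h1)
  rw [hsum, ← e.sum_sq_norm_inner_right v, Finset.mul_sum]
  gcongr with i
  exact hle i

/-- A representation by isometries of dimension less than `d` of a `d`-quasirandom group is
trivial. -/
theorem IsQuasirandom.isometric_rep_eq_one {G : Type*} [Group G] {d : ℕ} (hG : IsQuasirandom d G)
    (ρ : G →* (E →ₗ[ℂ] E)) (hρ : ∀ g v, ‖ρ g v‖ = ‖v‖) (hd : Module.finrank ℂ E < d) (g : G) :
    ρ g = 1 := by
  let φ := LinearMap.toMatrixOrthonormal (stdOrthonormalBasis ℂ E)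
  have hunit (g) : φ (ρ g) ∈ Matrix.unitaryGroup (Fin (Module.finrank ℂ E)) ℂ := by
    rw [Matrix.mem_unitaryGroup_iff', ← map_star, ← map_mul]
    have : star (ρ g) * ρ g = 1 :=
      LinearIsometry.adjoint_comp_self' (⟨ρ g, hρ g⟩ : E →ₗᵢ[ℂ] E)
    rw [this, map_one]
  let f : G →* Matrix.unitaryGroup (Fin (Module.finrank ℂ E)) ℂ :=
    { toFun := fun g => ⟨φ (ρ g), hunit g⟩
      map_one' := Subtype.ext (by simp only [map_one]; rfl)
      map_mul' := fun g h => Subtype.ext (by simp only [map_mul]; rfl) }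
  have h1 : φ (ρ g) = 1 := congrArg Subtype.val (hG _ hd f g)
  exact φ.injective (h1.trans (map_one φ).symm)

end Operators

section Convolution

variable {G : Type*} [Group G]

/-- The right regular representation. -/
noncomputable def rightReg : G →* (EuclideanSpace ℂ G →ₗ[ℂ] EuclideanSpace ℂ G) where
  toFun g :=
    { toFun := fun f => WithLp.toLp 2 fun x => f (x * g)
      map_add' := fun _ _ => rfl
      map_smul' := fun _ _ => rfl }
  map_one' := by ext; simp
  map_mul' g h := by
    refine LinearMap.ext fun f => ?_
    ext x
    exact congrArg f (mul_assoc x g h).symm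

theorem rightReg_apply (g : G) (f : EuclideanSpace ℂ G) (x : G) : rightReg g f x = f (x * g) := rfl

variable [Fintype G]

/-- The operator `f ↦ (x ↦ ∑ y, φ (y x⁻¹) f y)`. -/
noncomputable def convOp (φ : G → ℂ) : EuclideanSpace ℂ G →ₗ[ℂ] EuclideanSpace ℂ G where
  toFun f := WithLp.toLp 2 fun x => ∑ y, φ (y * x⁻¹) * f y
  map_add' f g := by ext x; simp [mul_add, Finset.sum_add_distrib]
  map_smul' a f := by ext x; simp [Finset.mul_sum, mul_left_comm]

theorem convOp_apply (φ : G → ℂ) (f : EuclideanSpace ℂ G) (x : G) :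
    convOp φ f x = ∑ y, φ (y * x⁻¹) * f y := rfl

theorem inner_rightReg_left (g : G) (f k : EuclideanSpace ℂ G) :
    inner ℂ (rightReg g f) k = inner ℂ f (rightReg g⁻¹ k) := by
  rw [PiLp.inner_apply, PiLp.inner_apply]
  exact Fintype.sum_equiv (Equiv.mulRight g) _ _ fun x => by simp [rightReg_apply]

theorem norm_rightReg (g : G) (f : EuclideanSpace ℂ G) : ‖rightReg g f‖ = ‖f‖ := by
  have h : inner ℂ (rightReg g f) (rightReg g f) = inner ℂ f f := by
    rw [inner_rightReg_left, ← Module.End.mul_apply, ← map_mul]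
    simp
  rw [inner_self_eq_norm_sq_to_K, inner_self_eq_norm_sq_to_K] at h
  have h' : ‖rightReg g f‖ ^ 2 = ‖f‖ ^ 2 := by exact_mod_cast h
  exact (pow_left_inj₀ (norm_nonneg _) (norm_nonneg _) two_ne_zero).1 h'

theorem convOp_rightReg (φ : G → ℂ) (g : G) (f : EuclideanSpace ℂ G) :
    convOp φ (rightReg g f) = rightReg g (convOp φ f) := by
  ext x
  rw [rightReg_apply, convOp_apply, convOp_apply]
  exact Fintype.sum_equiv (Equiv.mulRight g) _ _ fun y => by simp [rightReg_apply, mul_assoc]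

theorem adjoint_convOp_rightReg (φ : G → ℂ) (g : G) (f : EuclideanSpace ℂ G) :
    (convOp φ).adjoint (rightReg g f) = rightReg g ((convOp φ).adjoint f) := by
  refine ext_inner_right ℂ fun v => ?_
  rw [LinearMap.adjoint_inner_left, inner_rightReg_left, inner_rightReg_left,
    LinearMap.adjoint_inner_left, convOp_rightReg]

/-- Hilbert–Schmidt bound for the operator `convOp φ` on an orthonormal family. -/
theorem sum_norm_sq_convOp_le (φ : G → ℂ) {ι : Type*} [Fintype ι] (b : ι → EuclideanSpace ℂ G)
    (hb : Orthonormal ℂ b) :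
    ∑ i, ‖convOp φ (b i)‖ ^ 2 ≤ Fintype.card G * ∑ y, ‖φ y‖ ^ 2 := by
  let k (x : G) : EuclideanSpace ℂ G := WithLp.toLp 2 fun y => star (φ (y * x⁻¹))
  have hk (x : G) : ‖k x‖ ^ 2 = ∑ y, ‖φ y‖ ^ 2 := by
    rw [EuclideanSpace.norm_sq_eq]
    exact Fintype.sum_equiv (Equiv.mulRight x⁻¹) _ _ fun y => by simp [k]
  have hT (i) (x : G) : ‖convOp φ (b i) x‖ = ‖inner ℂ (b i) (k x)‖ := by
    rw [norm_inner_symm, convOp_apply, PiLp.inner_apply]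
    simp [k, mul_comm]
  simp_rw [EuclideanSpace.norm_sq_eq (convOp φ _), hT]
  rw [Finset.sum_comm]
  calc _ ≤ ∑ x : G, ‖k x‖ ^ 2 := by
        gcongr with x
        exact hb.sum_inner_products_le (k x)
    _ = _ := by simp [hk]

/-- In a `d`-quasirandom group, convolution with a mean zero function has small operator norm. -/
theorem IsQuasirandom.norm_sq_convOp_le {d : ℕ} (hG : IsQuasirandom d G) (hd : 0 < d) (φ : G → ℂ)
    (hφ : ∑ y, φ y = 0) (f : EuclideanSpace ℂ G) :
    ‖convOp φ f‖ ^ 2 ≤ (Fintype.card G * ∑ y, ‖φ y‖ ^ 2) / d * ‖f‖ ^ 2 := by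
  refine norm_sq_apply_le_of_eigenvalue_le _ _ (fun μ v hv hμ => ?_) f
  have hd' : (0 : ℝ) < d := by exact_mod_cast hd
  rcases le_or_gt μ 0 with h0 | h0
  · exact h0.trans (by positivity)
  let W := Module.End.eigenspace ((convOp φ).adjoint ∘ₗ convOp φ) (μ : ℂ)
  have hW {w} : w ∈ W ↔ (convOp φ).adjoint (convOp φ w) = (μ : ℂ) • w :=
    Module.End.mem_eigenspace_iff
  have hinv (g : G) : ∀ w ∈ W, rightReg g w ∈ W := fun w hw => by
    rw [hW] at hw ⊢
    rw [convOp_rightReg, adjoint_convOp_rightReg, hw, map_smul]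
  let ρ : G →* (W →ₗ[ℂ] W) :=
    { toFun := fun g => (rightReg g).restrict (hinv g)
      map_one' := by ext; simp
      map_mul' := fun g h => by ext; simp }
  have hdim : d ≤ Module.finrank ℂ W := by
    by_contra! hlt
    have htriv (g : G) : rightReg g v = v :=
      congrArg Subtype.val (LinearMap.congr_fun
        (hG.isometric_rep_eq_one ρ (fun g w => norm_rightReg g w) hlt g) ⟨v, hW.2 hμ⟩)
    have hconst (y : G) : v y = v 1 := by
      conv_rhs => rw [← htriv y, rightReg_apply, one_mul]
    have hzero : convOp φ v = 0 := by
      ext x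
      rw [convOp_apply]
      simp_rw [hconst]
      rw [← Finset.sum_mul, show ∑ y, φ (y * x⁻¹) = 0 from
        (Equiv.sum_comp (Equiv.mulRight x⁻¹) φ).trans hφ, zero_mul]
      rfl
    rw [hzero, map_zero] at hμ
    rcases smul_eq_zero.1 hμ.symm with h | h
    · exact h0.ne' (by exact_mod_cast h)
    · exact hv h
  let b := stdOrthonormalBasis ℂ W
  have hbW (i) : ‖convOp φ (b i : EuclideanSpace ℂ G)‖ ^ 2 = μ := by
    have h1 : inner ℂ (convOp φ (b i : EuclideanSpace ℂ G)) (convOp φ (b i : EuclideanSpace ℂ G))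
        = (μ : ℂ) := by
      rw [← LinearMap.adjoint_inner_right, hW.1 (b i).2, inner_smul_right,
        inner_self_eq_norm_sq_to_K]
      have : ‖(b i : EuclideanSpace ℂ G)‖ = 1 := b.orthonormal.norm_eq_one i
      simp [this]
    rw [inner_self_eq_norm_sq_to_K] at h1
    exact Complex.ofReal_injective (by simpa using h1)
  have hHS := sum_norm_sq_convOp_le φ (fun i => (b i : EuclideanSpace ℂ G))
    (b.orthonormal.comp_linearIsometry W.subtypeₗᵢ)
  simp_rw [hbW] at hHS
  rw [Finset.sum_const, Finset.card_univ, Fintype.card_fin, nsmul_eq_mul] at hHS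
  rw [le_div_iff₀ hd']
  have : (d : ℝ) ≤ Module.finrank ℂ W := by exact_mod_cast hdim
  nlinarith

end Convolution

/-- **Gowers' product theorem**: if `d |A| |B| |C| > |G|³` then `A B C = G`. -/
theorem IsQuasirandom.mul_mul_eq_univ {G : Type*} [Group G] [Fintype G] {d : ℕ}
    (hG : IsQuasirandom d G) (hd : 0 < d) (A B C : Set G)
    (h : (Fintype.card G : ℝ) ^ 3 < d * (A.ncard * B.ncard * C.ncard)) :
    A * B * C = Set.univ := by
  classical
  by_contra hne
  obtain ⟨g, hg⟩ := (Set.ne_univ_iff_exists_notMem _).1 hne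
  have hn : (0 : ℝ) < Fintype.card G := by exact_mod_cast Fintype.card_pos
  have hd' : (0 : ℝ) < d := by exact_mod_cast hd
  set n : ℝ := (Fintype.card G : ℝ) with hn_def
  have hcard (S : Set G) : ∑ x, S.indicator (1 : G → ℝ) x = S.ncard := by
    simp [Set.indicator_apply, Set.ncard_eq_toFinset_card']
  have hpos : (0 : ℝ) < A.ncard * B.ncard * C.ncard :=
    pos_of_mul_pos_right ((pow_pos hn 3).trans h) hd'.le
  have hB : (0 : ℝ) < B.ncard := by
    refine (Nat.cast_nonneg _).lt_of_ne fun h0 => ?_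
    simp [← h0] at hpos
  have hA : (0 : ℝ) < A.ncard := by
    refine (Nat.cast_nonneg _).lt_of_ne fun h0 => ?_
    simp [← h0] at hpos
  let φ (y : G) : ℂ := (B.indicator (1 : G → ℝ) y - B.ncard / n : ℝ)
  let F (y : G) : ℝ := A.indicator (1 : G → ℝ) (g * y⁻¹)
  let f : EuclideanSpace ℂ G := WithLp.toLp 2 fun y => (F y : ℂ)
  have hF : ∑ y, F y = A.ncard := by
    rw [← hcard A]
    exact Fintype.sum_equiv ((Equiv.inv G).trans (Equiv.mulLeft g)) _ _ fun y => rfl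
  have hf : ‖f‖ ^ 2 = A.ncard := by
    rw [EuclideanSpace.norm_sq_eq, ← hF]
    refine Finset.sum_congr rfl fun y _ => ?_
    by_cases hy : g * y⁻¹ ∈ A <;> simp [f, F, hy]
  have hφ : ∑ y, φ y = 0 := by
    rw [← Complex.ofReal_sum, Finset.sum_sub_distrib, hcard]
    simp [← hn_def, mul_div_cancel₀ _ hn.ne']
  have hφ2 : ∑ y, ‖φ y‖ ^ 2 ≤ B.ncard := by
    have h1 (y : G) : ‖φ y‖ ^ 2 =
        B.indicator (1 : G → ℝ) y * (1 - 2 * (B.ncard / n)) + (B.ncard / n) ^ 2 := by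
      rw [Complex.norm_real, Real.norm_eq_abs, sq_abs]
      by_cases hy : y ∈ B
      · simp only [hy, Set.indicator_of_mem, Pi.one_apply]
        ring
      · simp [hy]
    simp_rw [h1]
    rw [Finset.sum_add_distrib, ← Finset.sum_mul, hcard, Finset.sum_const, Finset.card_univ,
      nsmul_eq_mul, ← hn_def]
    have h2 : B.ncard * (1 - 2 * (B.ncard / n)) + n * (B.ncard / n) ^ 2
        = B.ncard - (B.ncard : ℝ) ^ 2 / n := by
      field_simp
      ring
    rw [h2]
    exact sub_le_self _ (by positivity)
  have hval : ∀ x ∈ C, convOp φ f x = ((-(B.ncard / n * A.ncard) : ℝ) : ℂ) := fun x hx => by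
    rw [convOp_apply, ← hF, Finset.mul_sum, ← Finset.sum_neg_distrib, Complex.ofReal_sum]
    refine Finset.sum_congr rfl fun y _ => ?_
    by_cases hy : g * y⁻¹ ∈ A
    · have hyB : y * x⁻¹ ∉ B := fun hyB => hg
        ⟨_, ⟨_, hy, _, hyB, rfl⟩, x, hx, by simp⟩
      simp [φ, f, F, hy, hyB]
    · simp [f, F, hy]
  have hlow : C.ncard * (B.ncard / n * A.ncard) ^ 2 ≤ ‖convOp φ f‖ ^ 2 := by
    rw [EuclideanSpace.norm_sq_eq, ← hcard C, Finset.sum_mul]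
    refine Finset.sum_le_sum fun x _ => ?_
    by_cases hx : x ∈ C
    · rw [hval x hx, Complex.norm_real, Real.norm_eq_abs, sq_abs]
      simp [hx]
    · simp [hx]
  have hmain : C.ncard * (B.ncard / n * A.ncard) ^ 2 ≤ n * B.ncard / d * A.ncard := by
    refine (hlow.trans (hG.norm_sq_convOp_le hd φ hφ f)).trans ?_
    rw [hf]
    gcongr
  have hfin : (d * (A.ncard * B.ncard * C.ncard)) * (A.ncard * B.ncard : ℝ)
      ≤ n ^ 3 * (A.ncard * B.ncard) := by
    have h3 := mul_le_mul_of_nonneg_left hmain (show 0 ≤ n ^ 2 * d by positivity)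
    field_simp at h3
    nlinarith
  exact absurd (le_of_mul_le_mul_right hfin (by positivity)) h.not_ge

theorem stmt_11 (c : ℝ) (hc : 0 < c) :
    ∃ d : ℕ, 0 < d ∧
      ∀ (G : Type) [Group G] [Fintype G],
        IsQuasirandom d G →
        ∀ A B C : Set G, c * (Fintype.card G : ℝ) ≤ (A.ncard : ℝ) →
          c * (Fintype.card G : ℝ) ≤ (B.ncard : ℝ) →
          c * (Fintype.card G : ℝ) ≤ (C.ncard : ℝ) →
          A * B * C = Set.univ := by
  obtain ⟨d, hd⟩ := exists_nat_gt (1 / c ^ 3)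
  have hd0 : (0 : ℝ) < d := lt_trans (by positivity) hd
  refine ⟨d, by exact_mod_cast hd0, fun G _ _ hG A B C hA hB hC =>
    hG.mul_mul_eq_univ (by exact_mod_cast hd0) A B C ?_⟩
  have hn : (0 : ℝ) < Fintype.card G := by exact_mod_cast Fintype.card_pos
  rw [div_lt_iff₀ (by positivity)] at hd
  calc (Fintype.card G : ℝ) ^ 3 < d * c ^ 3 * (Fintype.card G : ℝ) ^ 3 :=
        lt_mul_of_one_lt_left (by positivity) hd
    _ = d * (c * Fintype.card G * (c * Fintype.card G) * (c * Fintype.card G)) := by ring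
    _ ≤ _ := by gcongr
end
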